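/- Let p be an odd prime, let q be an odd prime power, and let f ∈ 𝔽_q[T] be a squarefree polynomial of odd degree. For n ≥ 0 let R_n = 𝔽_{q^{p^n}}[T][x]/(x² − f), and let e_n = v_p(#Cl(R_n)) be the exponent of the largest power of p dividing the class number of R_n. Then there exist a nonnegative integer λ, an integer ν, and an index N such that e_n = λ·n + ν for all n ≥ N. -/

import Mathlib

open Polynomial

lemma single_growth {p : ℕ} [Fact p.Prime] (α : PadicAlgCl p) (hα : ‖α‖ ≤ 1) :
    ∃ (l N : ℕ) (C : ℝ), ∀ n ≥ N, ‖1 - α ^ (p ^ n)‖ * (p : ℝ) ^ (l * n) = C := by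
  have hp : p.Prime := Fact.out
  have hp1 : (1 : ℝ) < p := by exact_mod_cast hp.one_lt
  have hp0 : (0 : ℝ) < p := by linarith
  have hpn : ‖(p : PadicAlgCl p)‖ = (p : ℝ)⁻¹ := by
    rw [← map_natCast (algebraMap ℚ_[p] (PadicAlgCl p)), PadicAlgCl.norm_extends, Padic.norm_p]
  have hadd : ∀ a b : PadicAlgCl p, ‖a + b‖ ≤ max ‖a‖ ‖b‖ := fun a b =>
    IsUltrametricDist.norm_add_le_max a b
  have hpow : ∀ j, ‖α ^ j‖ ≤ 1 := fun j => by
    rw [norm_pow]; exact pow_le_one₀ (norm_nonneg _) hα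
  set x : ℕ → PadicAlgCl p := fun n => α ^ (p ^ n) - 1 with hx
  have hx1 : ∀ n, ‖x n‖ ≤ 1 := fun n => by
    have := hadd (α ^ (p ^ n)) (-1)
    rw [norm_neg, norm_one, ← sub_eq_add_neg] at this
    exact this.trans (max_le (hpow _) le_rfl)
  have hnat : ∀ j : ℕ, ‖(j : PadicAlgCl p)‖ ≤ 1 := fun j => by
    rw [← map_natCast (algebraMap ℚ_[p] (PadicAlgCl p)), PadicAlgCl.norm_extends]
    exact_mod_cast Padic.norm_int_le_one (p := p) (j : ℤ)
  -- integrality subring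
  let O : Subring (PadicAlgCl p) :=
    { carrier := {y | ‖y‖ ≤ 1}
      mul_mem' := fun {a b} ha hb => by
        simp only [Set.mem_ofPred_eq, norm_mul] at *
        exact mul_le_one₀ ha (norm_nonneg _) hb
      one_mem' := by simp
      add_mem' := fun {a b} ha hb => (hadd a b).trans (max_le ha hb)
      zero_mem' := by simp
      neg_mem' := fun {a} ha => by simpa using ha }
  have hO : ∀ y, y ∈ O ↔ ‖y‖ ≤ 1 := fun y => Iff.rfl
  have hαO : α ∈ O := hα
  -- recursion
  have hrec : ∀ n, ∃ z ∈ O, x (n + 1) = x n * (p + x n * z) := by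
    intro n
    set β : O := ⟨α, hαO⟩ ^ (p ^ n) with hβ
    have h1 : (β - 1) ∣ (∑ i ∈ Finset.range p, β ^ i) - p := by
      have : (∑ i ∈ Finset.range p, β ^ i) - p = ∑ i ∈ Finset.range p, (β ^ i - 1) := by
        simp
      rw [this]
      refine Finset.dvd_sum fun i _ => ?_
      simpa using sub_dvd_pow_sub_pow β 1 i
    obtain ⟨z, hz⟩ := h1
    refine ⟨z, z.2, ?_⟩
    have h2 : β ^ p - 1 = (β - 1) * (p + (β - 1) * z) := by
      rw [← hz, ← mul_geom_sum]; ring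
    have h3 := congrArg (Subtype.val) h2
    simp only [hβ, AddSubgroupClass.coe_sub, Subring.coe_mul, Subring.coe_add, Subring.coe_pow, Subring.coe_one, Subring.coe_natCast] at h3
    rw [← pow_mul, ← pow_succ] at h3
    exact h3
  have hle : ∀ n, ‖x (n + 1)‖ ≤ ‖x n‖ * max (p : ℝ)⁻¹ ‖x n‖ := by
    intro n
    obtain ⟨z, hz, h⟩ := hrec n
    rw [h, norm_mul]
    gcongr
    refine (hadd _ _).trans ?_
    rw [hpn]
    refine max_le_max le_rfl ?_
    rw [norm_mul]
    exact mul_le_of_le_one_right (norm_nonneg _) hz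
  have hsm : ∀ n, ‖x n‖ < (p : ℝ)⁻¹ → ‖x (n + 1)‖ = ‖x n‖ * (p : ℝ)⁻¹ := by
    intro n hn
    obtain ⟨z, hz, h⟩ := hrec n
    rw [h, norm_mul, ← hpn]
    congr 1
    have h5 : ‖x n * z‖ < ‖(p : PadicAlgCl p)‖ := by
      rw [hpn, norm_mul]
      exact (mul_le_of_le_one_right (norm_nonneg _) hz).trans_lt hn
    exact IsUltrametricDist.norm_add_eq_max_of_norm_ne_norm h5.ne' |>.trans (max_eq_left h5.le)
  have hsym : ∀ n, ‖1 - α ^ (p ^ n)‖ = ‖x n‖ := fun n => norm_sub_rev _ _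
  simp only [hsym]
  by_cases h0 : ‖x 0‖ < 1
  · set r := max (p : ℝ)⁻¹ ‖x 0‖ with hr
    have hr1 : r < 1 := max_lt (inv_lt_one_of_one_lt₀ hp1) h0
    have hr0 : 0 ≤ r := le_max_of_le_right (norm_nonneg _)
    have hb : ∀ n, ‖x n‖ ≤ r ^ (n + 1) := by
      intro n
      induction n with
      | zero => rw [zero_add, pow_one]; exact le_max_right _ _
      | succ n ih =>
        refine (hle n).trans ?_
        rw [pow_succ r (n+1)]
        have : ‖x n‖ ≤ r := ih.trans (pow_le_of_le_one hr0 hr1.le (by simp))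
        exact mul_le_mul ih (max_le (le_max_left _ _) this) (le_max_of_le_right (norm_nonneg _)) (by positivity)
    obtain ⟨N, hN⟩ := exists_pow_lt_of_lt_one (inv_pos.mpr hp0) hr1
    have hN' : ∀ n ≥ N, ‖x n‖ < (p : ℝ)⁻¹ := fun n hn =>
      (hb n).trans_lt ((pow_le_pow_of_le_one hr0 hr1.le (by omega)).trans_lt hN)
    refine ⟨1, N, ‖x N‖ * (p : ℝ) ^ (1 * N), fun n hn => ?_⟩
    induction n, hn using Nat.le_induction with
    | base => rfl
    | succ n hn ih =>
      rw [← ih, hsm n (hN' n hn)]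
      field_simp
      ring
  · have h0 : ‖x 0‖ = 1 := le_antisymm (hx1 0) (not_lt.mp h0)
    refine ⟨0, 0, 1, fun n hn => ?_⟩
    clear hn
    simp only [zero_mul, pow_zero, mul_one]
    induction n with
    | zero => exact h0
    | succ n ih =>
      set β : O := ⟨α, hαO⟩ ^ (p ^ n) with hβ
      obtain ⟨r, hr⟩ := exists_add_pow_prime_eq hp (β - 1) 1
      have h3 := congrArg (Subtype.val) hr
      simp only [sub_add_cancel, one_pow, mul_one, hβ, AddSubgroupClass.coe_sub, Subring.coe_mul, Subring.coe_add, Subring.coe_pow, Subring.coe_one, Subring.coe_natCast] at h3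
      rw [← pow_mul, ← pow_succ] at h3
      have h4 : x (n+1) = (x n) ^ p + p * ((x n) * r.1) := by
        simp only [hx]; rw [h3]; ring
      rw [h4]
      have h5 : ‖(p : PadicAlgCl p) * (x n * r.1)‖ < ‖x n ^ p‖ := by
        rw [norm_pow, ih, one_pow, norm_mul, norm_mul, ih, one_mul, hpn]
        exact (mul_le_of_le_one_right (by positivity) r.2).trans_lt (inv_lt_one_of_one_lt₀ hp1)
      rw [IsUltrametricDist.norm_add_eq_max_of_norm_ne_norm h5.ne', max_eq_left h5.le, norm_pow, ih, one_pow]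

lemma multiset_growth {p : ℕ} [Fact p.Prime] (s : Multiset (PadicAlgCl p)) :
    (∀ α ∈ s, ‖α‖ ≤ 1) → 
    ∃ (l N : ℕ) (C : ℝ), ∀ n ≥ N, ‖(s.map (fun α => 1 - α ^ (p ^ n))).prod‖ * (p : ℝ) ^ (l * n) = C := by
  induction s using Multiset.induction with
  | empty => intro _; exact ⟨0, 0, 1, by simp⟩
  | cons a s ih =>
    intro hs
    obtain ⟨l, N, C, h⟩ := ih (fun α hα => hs α (Multiset.mem_cons_of_mem hα))
    obtain ⟨l', N', C', h'⟩ := single_growth a (hs a (Multiset.mem_cons_self a s))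
    refine ⟨l' + l, max N N', C' * C, fun n hn => ?_⟩
    rw [← h n (le_of_max_le_left hn), ← h' n (le_of_max_le_right hn), Multiset.map_cons, Multiset.prod_cons, norm_mul]
    ring

theorem padic_growth {p : ℕ} [Fact p.Prime] (s : Multiset (PadicAlgCl p))
    (hs : ∀ α ∈ s, ‖α‖ ≤ 1) (h : ℕ → ℕ) (hh : ∀ n, h n ≠ 0)
    (heq : ∀ n, (h n : PadicAlgCl p) = (s.map (fun α => 1 - α ^ (p ^ n))).prod) :
    ∃ (lam : ℕ) (ν : ℤ) (N : ℕ), ∀ n ≥ N, ((h n).factorization p : ℤ) = lam * n + ν := by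
  have hp : p.Prime := Fact.out
  have hp1 : (1 : ℝ) < p := by exact_mod_cast hp.one_lt
  have hp0 : (p : ℝ) ≠ 0 := by linarith
  obtain ⟨l, N, C, hC⟩ := multiset_growth s hs
  have key : ∀ n, ‖(s.map (fun α => 1 - α ^ (p ^ n))).prod‖ = (p : ℝ) ^ (-((h n).factorization p : ℤ)) := by
    intro n
    rw [← heq, ← map_natCast (algebraMap ℚ_[p] (PadicAlgCl p)), PadicAlgCl.norm_extends,
      Padic.norm_eq_zpow_neg_valuation (by exact_mod_cast hh n), Padic.valuation_natCast,
      Nat.factorization_def _ hp]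
  refine ⟨l, (h N).factorization p - l * N, N, fun n hn => ?_⟩
  have h1 := (hC n hn).trans (hC N le_rfl).symm
  rw [key, key, ← zpow_natCast, ← zpow_natCast, ← zpow_add₀ hp0, ← zpow_add₀ hp0] at h1
  have h2 := zpow_right_injective₀ (by linarith) hp1.ne' h1
  push_cast at h2
  linarith

set_option linter.unusedSectionVars false

section PS
variable {Ω : Type*} [Field Ω] [CharZero Ω]

/-- the Euler operator `X d/dX` -/
noncomputable def eulerOp (F : PowerSeries Ω) : PowerSeries Ω :=
  PowerSeries.X * PowerSeries.derivative Ω F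

lemma eulerOp_mul (F G : PowerSeries Ω) : eulerOp (F * G) = eulerOp F * G + F * eulerOp G := by
  simp only [eulerOp, Derivation.leibniz, smul_eq_mul]; ring

lemma coeff_eulerOp (F : PowerSeries Ω) (d : ℕ) :
    PowerSeries.coeff d (eulerOp F) = d * PowerSeries.coeff d F := by
  cases d with
  | zero => simp [eulerOp]
  | succ d =>
    rw [eulerOp, PowerSeries.coeff_succ_X_mul, PowerSeries.coeff_derivative]
    push_cast; ring

/-- series with zero constant term and given higher coefficients -/
noncomputable def serOf (N : ℕ → Ω) : PowerSeries Ω :=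
  PowerSeries.mk fun s => if s = 0 then 0 else N s

lemma coeff_serOf_mul (N : ℕ → Ω) (A : PowerSeries Ω) (d : ℕ) :
    PowerSeries.coeff d (serOf N * A) =
      ∑ i ∈ Finset.range d, N (i + 1) * PowerSeries.coeff (d - (i + 1)) A := by
  rw [PowerSeries.coeff_mul, Finset.Nat.sum_antidiagonal_eq_sum_range_succ_mk,
    Finset.sum_range_succ']
  simp [serOf]

noncomputable def linFac (α : Ω) : PowerSeries Ω := 1 - PowerSeries.C α * PowerSeries.X

lemma eulerOp_linFac (α : Ω) :
    eulerOp (linFac α) = - serOf (fun s => α ^ s) * linFac α := by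
  ext d
  rw [coeff_eulerOp, neg_mul, map_neg, coeff_serOf_mul]
  have hc : ∀ d, PowerSeries.coeff d (linFac α) = if d = 0 then 1 else if d = 1 then -α else 0 := by
    intro d
    rcases d with _ | _ | d
    · simp [linFac]
    · simp [linFac, PowerSeries.coeff_one]
    · simp [linFac, PowerSeries.coeff_one, PowerSeries.coeff_succ_mul_X, PowerSeries.coeff_C]
  rcases d with _ | _ | d
  · simp
  · simp [hc]
  · rw [Finset.sum_range_succ, Finset.sum_range_succ, Finset.sum_eq_zero]
    · simp [hc]; ring
    · intro i hi
      rw [Finset.mem_range] at hi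
      rw [hc, if_neg (by omega), if_neg (by omega), mul_zero]

lemma serOf_add (f g : ℕ → Ω) : serOf (fun s => f s + g s) = serOf f + serOf g := by
  ext d; simp [serOf]; split_ifs <;> simp

lemma serOf_neg (f : ℕ → Ω) : serOf (fun s => - f s) = - serOf f := by
  ext d; simp [serOf]; split_ifs <;> simp

lemma serOf_sub (f g : ℕ → Ω) : serOf (fun s => f s - g s) = serOf f - serOf g := by
  ext d; simp [serOf]; split_ifs <;> simp

lemma eulerOp_prod (S : Multiset Ω) :
    eulerOp (S.map linFac).prod =
      - serOf (fun s => (S.map (fun α => α ^ s)).sum) * (S.map linFac).prod := by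
  induction S using Multiset.induction with
  | empty =>
    simp only [Multiset.map_zero, Multiset.prod_zero, Multiset.sum_zero]
    ext d; rw [coeff_eulerOp]; simp [serOf, PowerSeries.coeff_one]
  | cons a S ih =>
    simp only [Multiset.map_cons, Multiset.prod_cons, Multiset.sum_cons]
    rw [eulerOp_mul, ih, eulerOp_linFac, serOf_add]; ring

lemma euler_unique (E P W : PowerSeries Ω) (hE : eulerOp E = W * E) (hP : eulerOp P = W * P)
    (hE0 : PowerSeries.constantCoeff E = 1) (hP0 : PowerSeries.constantCoeff P = 1) : E = P := by
  have hPn : P ≠ 0 := by rintro rfl; simp at hP0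
  have hPi : P * P⁻¹ = 1 := PowerSeries.mul_inv_cancel P (by rw [hP0]; exact one_ne_zero)
  set F := P⁻¹ * E with hF
  have hEF : E = P * F := by rw [hF, ← mul_assoc, hPi, one_mul]
  have h1 : P * eulerOp F = 0 := by
    have := hE
    rw [hEF, eulerOp_mul, hP] at this
    linear_combination this
  have h2 : eulerOp F = 0 := (mul_eq_zero.mp h1).resolve_left hPn
  have hF0 : PowerSeries.constantCoeff F = 1 := by
    have := congrArg PowerSeries.constantCoeff hEF
    rwa [map_mul, hP0, hE0, one_mul, eq_comm] at this
  have h3 : F = 1 := by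
    ext d
    rcases d with _ | d
    · simpa using hF0
    · have := congrArg (PowerSeries.coeff (d+1)) h2
      rw [coeff_eulerOp, map_zero] at this
      rw [PowerSeries.coeff_one, if_neg (by omega)]
      exact (mul_eq_zero.mp this).resolve_left (by exact_mod_cast Nat.succ_ne_zero d)
  rw [hEF, h3, mul_one]

lemma constantCoeff_prod (S : Multiset Ω) :
    PowerSeries.constantCoeff (S.map linFac).prod = 1 := by
  rw [map_multiset_prod, Multiset.map_map]
  apply Multiset.prod_eq_one
  intro x hx
  obtain ⟨α, -, rfl⟩ := Multiset.mem_map.mp hx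
  simp [linFac]

lemma coe_prod (S : Multiset Ω) :
    (((S.map (fun α => 1 - C α * X)).prod : Polynomial Ω) : PowerSeries Ω) = (S.map linFac).prod := by
  rw [← Polynomial.coeToPowerSeries.ringHom_apply, map_multiset_prod, Multiset.map_map]
  congr 1
  apply Multiset.map_congr rfl
  intro α _
  simp [linFac]

lemma reverse_prod (S : Multiset Ω) :
    ((S.map (fun α => X - C α)).prod : Polynomial Ω).reverse = (S.map (fun α => 1 - C α * X)).prod := by
  induction S using Multiset.induction with
  | empty =>
    simp only [Multiset.map_zero, Multiset.prod_zero]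
    rw [← C_1, reverse_C]
  | cons a S ih =>
    simp only [Multiset.map_cons, Multiset.prod_cons]
    rw [reverse_mul_of_domain, ih]
    congr 1
    ext n
    rw [coeff_reverse, natDegree_X_sub_C]
    rcases n with _ | _ | n
    · rw [revAt_le (by omega)]; simp [coeff_C]
    · rw [revAt_le (by omega)]; simp [coeff_one]
    · rw [revAt_eq_self_of_lt (by omega)]
      simp [coeff_X, coeff_one, coeff_C]

/-- Factorization of an integral polynomial with constant term one. -/
lemma exists_factor [IsAlgClosed Ω] (L : ℤ[X]) (hL : L.coeff 0 = 1) :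
    ∃ S : Multiset Ω, (∀ α ∈ S, IsIntegral ℤ α) ∧
      L.map (Int.castRingHom Ω) = (S.map (fun α => 1 - C α * X)).prod := by
  have hL0 : L ≠ 0 := by rintro rfl; simp at hL
  have hm : L.reverse.Monic := by
    rw [Monic, reverse_leadingCoeff, trailingCoeff, natTrailingDegree_eq_zero.mpr (Or.inr (by simp [hL])), hL]
  have hm' : (L.reverse.map (Int.castRingHom Ω)).Monic := hm.map _
  refine ⟨(L.reverse.map (Int.castRingHom Ω)).roots, fun α hα => ?_, ?_⟩
  · refine ⟨L.reverse, hm, ?_⟩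
    have := (mem_roots'.mp hα).2
    rw [IsRoot, eval_map] at this
    have h9 : Int.castRingHom Ω = algebraMap ℤ Ω := Subsingleton.elim _ _
    rw [h9] at this
    exact this
  · rw [← reverse_prod]
    have h1 := (IsAlgClosed.splits (L.reverse.map (Int.castRingHom Ω))).eq_prod_roots_of_monic hm'
    rw [← h1]
    have h2 : ∀ (P : ℤ[X]), (P.map (Int.castRingHom Ω)).reverse = P.reverse.map (Int.castRingHom Ω) := by
      intro P
      rw [reverse, reverse, natDegree_map_eq_of_injective (RingHom.injective_int _), reflect_map]
    rw [h2]
    congr 1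
    rw [reverse, reverse_natDegree, natTrailingDegree_eq_zero.mpr (Or.inr (by simp [hL])), Nat.sub_zero, reverse, reflect_reflect]
    
lemma sum_coeff_eq_eval (P : Polynomial Ω) (n : ℕ) (hn : P.natDegree < n) :
    ∑ d ∈ Finset.range n, P.coeff d = P.eval 1 := by
  rw [eval_eq_sum_range' hn]; simp

theorem roots_exist [IsAlgClosed Ω] (q : ℕ) (a N : ℕ → ℕ) (ha0 : a 0 = 1)
    (hrec : ∀ d, d * a d = ∑ i ∈ Finset.range d, N (i + 1) * a (d - (i + 1)))
    (D0 : ℕ) (hev : ∀ d ≥ D0, a (d + 1) = q * a d) :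
    ∃ S : Multiset Ω, (∀ α ∈ S, IsIntegral ℤ α) ∧
      ∀ (m : ℕ) (_ : 0 < m) (b : ℕ → ℕ) (_ : b 0 = 1)
        (_ : ∀ d, d * b d = ∑ i ∈ Finset.range d, N (m * (i + 1)) * b (d - (i + 1)))
        (h D1 : ℕ) (_ : ∀ D ≥ D1, ∑ d ∈ Finset.range (D + 2), b d
            = h + q ^ m * ∑ d ∈ Finset.range (D + 1), b d),
        (h : Ω) = (S.map (fun α => 1 - α ^ m)).prod := by
  set cc : ℕ → ℤ := fun d => if d = 0 then 1 else (a d : ℤ) - q * a (d - 1) with hcc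
  set L : ℤ[X] := ∑ d ∈ Finset.range (D0 + 1), monomial d (cc d) with hLdef
  have hLc : ∀ d, L.coeff d = cc d := by
    intro d
    simp only [hLdef, finsetSum_coeff, coeff_monomial]
    rw [Finset.sum_ite_eq' (Finset.range (D0+1)) d]
    split_ifs with hd
    · rfl
    · rw [Finset.mem_range] at hd
      simp only [hcc]
      rw [if_neg (by omega)]
      have := hev (d - 1) (by omega)
      rw [Nat.sub_add_cancel (by omega)] at this
      rw [this]; push_cast; ring
  obtain ⟨S, hSint, hS⟩ := exists_factor (Ω := Ω) L (by rw [hLc]; simp [hcc])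
  refine ⟨S, hSint, ?_⟩
  -- generic facts on generating series
  have gen : ∀ (b M : ℕ → ℕ) (_ : ∀ d, d * b d = ∑ i ∈ Finset.range d, M (i + 1) * b (d - (i + 1))),
      eulerOp (PowerSeries.mk fun d => (b d : Ω)) =
        serOf (fun s => (M s : Ω)) * PowerSeries.mk fun d => (b d : Ω) := by
    intro b M hb
    ext d
    rw [coeff_eulerOp, coeff_serOf_mul]
    simp only [PowerSeries.coeff_mk]
    exact_mod_cast hb d
  have lin_coeff : ∀ (b : ℕ → ℕ) (Q : ℕ) (d : ℕ),
      PowerSeries.coeff d (linFac (Q : Ω) * PowerSeries.mk fun d => (b d : Ω)) =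
        if d = 0 then (b 0 : Ω) else b d - Q * b (d - 1) := by
    intro b Q d
    rcases d with _ | d
    · simp [linFac]
    · rw [linFac, sub_mul, one_mul, mul_assoc, map_sub, PowerSeries.coeff_C_mul, PowerSeries.coeff_succ_X_mul]
      simp
  set A : PowerSeries Ω := PowerSeries.mk fun d => (a d : Ω) with hA
  have hLA : linFac (q : Ω) * A = (S.map linFac).prod := by
    rw [← coe_prod, ← hS]
    ext d
    rw [lin_coeff, coeff_coe, coeff_map, hLc]
    simp only [hcc]
    split_ifs <;> simp [ha0]
  have hLAne : linFac (q : Ω) * A ≠ 0 := by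
    intro h0
    have := constantCoeff_prod S
    rw [← hLA, h0] at this
    simp at this
  have hNser : serOf (fun s => (N s : Ω)) = serOf (fun s => (q : Ω) ^ s - (S.map (fun α => α ^ s)).sum) := by
    have h1 := congrArg eulerOp hLA
    rw [eulerOp_prod, ← hLA, eulerOp_mul, eulerOp_linFac, gen a N hrec] at h1
    rw [serOf_sub]
    apply mul_right_cancel₀ hLAne
    linear_combination h1
  have hNs : ∀ s, s ≠ 0 → (N s : Ω) = (q : Ω) ^ s - (S.map (fun α => α ^ s)).sum := by
    intro s hs
    have := congrArg (PowerSeries.coeff s) hNser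
    simpa [serOf, hs] using this
  intro m hm b hb0 hbrec h D1 hh
  set B : PowerSeries Ω := PowerSeries.mk fun d => (b d : Ω) with hB
  set S' := S.map (fun α => α ^ m) with hS'
  have hser' : serOf (fun s => ((N (m * s) : ℕ) : Ω)) =
      serOf (fun s => ((q ^ m : ℕ) : Ω) ^ s) - serOf (fun s => (S'.map (fun α => α ^ s)).sum) := by
    rw [← serOf_sub]
    ext s
    simp only [serOf, PowerSeries.coeff_mk]
    split_ifs with hs
    · rfl
    · rw [hNs _ (Nat.mul_ne_zero hm.ne' hs), hS', Multiset.map_map]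
      push_cast
      simp only [Function.comp_def, pow_mul]
  have hE : linFac ((q ^ m : ℕ) : Ω) * B = (S'.map linFac).prod := by
    refine euler_unique _ _ (- serOf (fun s => (S'.map (fun α => α ^ s)).sum)) ?_ (eulerOp_prod S') ?_ (constantCoeff_prod S')
    · rw [eulerOp_mul, eulerOp_linFac, gen b (fun s => N (m * s)) hbrec, hser']
      ring
    · simp [linFac, hB, hb0]
  rw [← coe_prod] at hE
  set P : Polynomial Ω := (S'.map (fun α => 1 - C α * X)).prod with hP
  have hPev : P.eval 1 = (S.map (fun α => 1 - α ^ m)).prod := by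
    rw [hP, eval_multiset_prod, Multiset.map_map, hS', Multiset.map_map]
    simp
  rw [← hPev, ← sum_coeff_eq_eval P (max D1 P.natDegree + 2) (by omega)]
  have hcoef : ∀ d, P.coeff d = if d = 0 then (b 0 : Ω) else b d - (q ^ m : ℕ) * b (d - 1) := by
    intro d
    rw [← lin_coeff, ← hB, hE, coeff_coe]
  have hsum := hh (max D1 P.natDegree) (by omega)
  rw [Finset.sum_range_succ']
  have h3 := congrArg (Nat.cast : ℕ → Ω) hsum
  rw [Finset.sum_range_succ'] at h3
  push_cast at h3
  simp only [hcoef, if_true, Nat.succ_ne_zero, if_false, Nat.add_sub_cancel, Finset.sum_sub_distrib, ← Finset.mul_sum]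
  push_cast
  linear_combination -h3
end PS

set_option linter.style.haveILetI false
set_option linter.unusedSectionVars false

section Zeta
variable (k : Type*) {R : Type*} [Field k] [CommRing R] [Algebra k R]

/-- degree of an ideal: `dim_k (R/I)` -/
noncomputable def ideg (I : Ideal R) : ℕ := Module.finrank k (R ⧸ I)

variable [IsDedekindDomain R]

lemma ideg_mul (hfin : ∀ I : Ideal R, I ≠ ⊥ → Module.Finite k (R ⧸ I)) {I J : Ideal R}
    (hI : I ≠ ⊥) (hJ : J ≠ ⊥) : ideg k (I * J) = ideg k I + ideg k J := by
  have hIJ : I * J ≠ ⊥ := mul_ne_zero hI hJ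
  have := hfin _ hIJ
  obtain ⟨a, ha⟩ := IsDedekindDomain.exists_sup_span_eq (Ideal.mul_le_left : I * J ≤ I) hIJ
  have haI : a ∈ I := by rw [← ha]; exact Ideal.mem_sup_right (Ideal.mem_span_singleton_self a)
  let g : (R ⧸ J) →ₗ[R] (R ⧸ (I * J)) := Submodule.mapQ J (I * J) (LinearMap.mulLeft R a)
    (fun x hx => Ideal.mul_mem_mul haI hx)
  let π : (R ⧸ (I * J)) →ₗ[R] (R ⧸ I) := Submodule.mapQ (I * J) I LinearMap.id
    (fun x hx => Ideal.mul_le_left hx)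
  have hπ : Function.Surjective π := by
    intro y
    obtain ⟨y, rfl⟩ := Submodule.Quotient.mk_surjective _ y
    exact ⟨Submodule.Quotient.mk y, rfl⟩
  have hg : Function.Injective g := by
    rw [← LinearMap.ker_eq_bot, LinearMap.ker_eq_bot']
    intro y hy
    obtain ⟨r, rfl⟩ := Submodule.Quotient.mk_surjective _ y
    have hr : a * r ∈ I * J := by
      rw [← Submodule.Quotient.mk_eq_zero (I * J)]; exact hy
    rw [Submodule.Quotient.mk_eq_zero]
    have h1 : I * Ideal.span {r} ≤ I * J := by
      nth_rewrite 1 [← ha]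
      rw [Ideal.sup_mul, Ideal.span_singleton_mul_span_singleton]
      exact sup_le Ideal.mul_le_left ((Ideal.span_singleton_le_iff_mem _).mpr hr)
    rw [← Ideal.dvd_iff_le, mul_dvd_mul_iff_left hI, Ideal.dvd_iff_le, Ideal.span_singleton_le_iff_mem] at h1
    exact h1
  have hker : LinearMap.ker π = LinearMap.range g := by
    ext y
    obtain ⟨r, rfl⟩ := Submodule.Quotient.mk_surjective _ y
    constructor
    · intro hy
      have hr : r ∈ I := by
        rw [← Submodule.Quotient.mk_eq_zero I]; exact hy
      rw [← ha, Submodule.mem_sup] at hr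
      obtain ⟨u, hu, v, hv, rfl⟩ := hr
      obtain ⟨w, rfl⟩ := Ideal.mem_span_singleton'.mp hv
      refine ⟨Submodule.Quotient.mk w, ?_⟩
      change Submodule.Quotient.mk (a * w) = _
      rw [eq_comm, Submodule.Quotient.eq]
      convert hu using 1; ring
    · rintro ⟨w, hw⟩
      obtain ⟨w, rfl⟩ := Submodule.Quotient.mk_surjective _ w
      rw [← hw]
      change Submodule.Quotient.mk (a * w) = 0
      rw [Submodule.Quotient.mk_eq_zero]
      exact Ideal.mul_mem_right _ _ haI
  have h1 := LinearMap.finrank_range_add_finrank_ker (π.restrictScalars k)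
  have h2 : LinearMap.range (π.restrictScalars k) = ⊤ := LinearMap.range_eq_top.mpr hπ
  have h3 : LinearMap.ker (π.restrictScalars k) = LinearMap.range (g.restrictScalars k) := by
    ext y
    have := SetLike.ext_iff.mp hker y
    exact this
  rw [h2, finrank_top, h3, LinearMap.finrank_range_of_inj (f := g.restrictScalars k) hg] at h1
  exact h1.symm

variable (hfin : ∀ I : Ideal R, I ≠ ⊥ → Module.Finite k (R ⧸ I))
include hfin

lemma ideg_pos {I : Ideal R} (hI : I ≠ ⊥) (hI' : I ≠ ⊤) : 0 < ideg k I := by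
  have := hfin I hI
  have : Nontrivial (R ⧸ I) := Ideal.Quotient.nontrivial_iff.mpr hI'
  exact Module.finrank_pos

lemma ideg_top : ideg k (⊤ : Ideal R) = 0 := by
  have : Subsingleton (R ⧸ (⊤ : Ideal R)) := Ideal.Quotient.subsingleton_iff.mpr rfl
  exact Module.finrank_zero_of_subsingleton

lemma ideg_pow {P : Ideal R} (hP : P ≠ ⊥) (j : ℕ) : ideg k (P ^ j) = j * ideg k P := by
  induction j with
  | zero => simp [Ideal.one_eq_top, ideg_top k hfin]
  | succ j ih => rw [pow_succ, ideg_mul k hfin (pow_ne_zero j hP) hP, ih]; ring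

lemma ideg_multiset (s : Multiset (Ideal R)) :
    (∀ P ∈ s, P ≠ ⊥) → ideg k s.prod = (s.map (ideg k)).sum ∧ s.prod ≠ ⊥ := by
  induction s using Multiset.induction with
  | empty => intro _; simp [Ideal.one_eq_top, ideg_top k hfin]
  | cons a s ih =>
    intro h
    obtain ⟨h1, h2⟩ := ih (fun P hP => h P (Multiset.mem_cons_of_mem hP))
    have h3 := h a (Multiset.mem_cons_self a s)
    rw [Multiset.prod_cons, Multiset.map_cons, Multiset.sum_cons, ideg_mul k hfin h3 h2, h1]
    exact ⟨rfl, mul_ne_zero h3 h2⟩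

open UniqueFactorizationMonoid in
open Classical in
lemma ideg_eq_sum {d : ℕ} (PP : Finset (Ideal R))
    (hPP : ∀ P, P ∈ PP ↔ P.IsMaximal ∧ P ≠ ⊥ ∧ ideg k P ≤ d) (I : Ideal R) (hI : I ≠ ⊥)
    (hd : ideg k I = d) :
    d = ∑ P ∈ PP, ∑ j ∈ Finset.range d, if P ^ (j + 1) ∣ I then ideg k P else 0 := by
  have hprod : (normalizedFactors I).prod = I := Ideal.prod_normalizedFactors_eq_self hI
  have hne : ∀ P ∈ normalizedFactors I, P ≠ ⊥ := fun P hP => (prime_of_normalized_factor P hP).ne_zero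
  have h1 := (ideg_multiset k hfin _ hne).1
  rw [hprod, hd, Finset.sum_multiset_map_count] at h1
  have hle : ∀ J : Ideal R, J ∣ I → ideg k J ≤ d := by
    rintro J ⟨J', rfl⟩
    rw [← hd, ideg_mul k hfin (left_ne_zero_of_mul hI) (right_ne_zero_of_mul hI)]
    omega
  have hsub : (normalizedFactors I).toFinset ⊆ PP := by
    intro P hP
    rw [Multiset.mem_toFinset] at hP
    have hpr := prime_of_normalized_factor P hP
    rw [hPP]
    exact ⟨(Ideal.isPrime_of_prime hpr).isMaximal hpr.ne_zero, hpr.ne_zero, hle P (dvd_of_mem_normalizedFactors hP)⟩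
  rw [Finset.sum_subset hsub] at h1
  · nth_rewrite 1 [h1]
    refine Finset.sum_congr rfl fun P hP => ?_
    obtain ⟨hPm, hP0, -⟩ := (hPP P).mp hP
    have hPirr : Irreducible P := (Ideal.prime_of_isPrime hP0 hPm.isPrime).irreducible
    have hdvd : ∀ j, P ^ j ∣ I ↔ j ≤ (normalizedFactors I).count P := by
      intro j
      rw [dvd_iff_normalizedFactors_le_normalizedFactors (pow_ne_zero j hP0) hI,
        normalizedFactors_pow, normalizedFactors_irreducible hPirr, Multiset.le_count_iff_replicate_le,
        normalize_eq, Multiset.nsmul_singleton]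
    have hcd : (normalizedFactors I).count P ≤ d := by
      have h2 := hle _ ((hdvd _).mpr le_rfl)
      rw [ideg_pow k hfin hP0] at h2
      have h3 := ideg_pos k hfin hP0 hPm.ne_top
      nlinarith
    rw [← Finset.sum_filter, Finset.sum_const]
    congr 1
    have : (Finset.range d).filter (fun j => P ^ (j + 1) ∣ I) = Finset.range ((normalizedFactors I).count P) := by
      ext j
      rw [Finset.mem_filter, hdvd, Finset.mem_range, Finset.mem_range]
      omega
    rw [this, Finset.card_range]
  · intro P _ hP
    rw [Multiset.mem_toFinset] at hP
    rw [Multiset.count_eq_zero_of_notMem hP, zero_smul]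

omit hfin [IsDedekindDomain R] [CommRing R] [Algebra k R] [Field k] in
lemma reindex_sum (c : ℕ → ℕ) (e d : ℕ) (he : 0 < e) :
    (∑ j ∈ Finset.range d, if (j + 1) * e ≤ d then c (d - (j + 1) * e) else 0) =
      ∑ i ∈ Finset.range d, if e ∣ i + 1 then c (d - (i + 1)) else 0 := by
  rw [← Finset.sum_filter, ← Finset.sum_filter]
  refine Finset.sum_bij' (fun j _ => (j + 1) * e - 1) (fun i _ => (i + 1) / e - 1) ?_ ?_ ?_ ?_ ?_
  · intro j hj
    rw [Finset.mem_filter, Finset.mem_range] at *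
    have : 0 < (j + 1) * e := by positivity
    rw [Nat.sub_add_cancel this]
    exact ⟨by omega, dvd_mul_left _ _⟩
  · intro i hi
    rw [Finset.mem_filter, Finset.mem_range] at *
    obtain ⟨hi, c, hc⟩ := hi
    have hc0 : 0 < c := by rcases Nat.eq_zero_or_pos c with rfl | h; · omega
                           · exact h
    rw [hc, Nat.mul_div_cancel_left _ he, Nat.sub_add_cancel hc0]
    have : c ≤ e * c := Nat.le_mul_of_pos_left _ he
    constructor
    · omega
    · rw [mul_comm]; omega
  · intro j hj
    have : 0 < (j + 1) * e := by positivity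
    rw [Nat.sub_add_cancel this, Nat.mul_div_cancel _ he]; rfl
  · intro i hi
    rw [Finset.mem_filter, Finset.mem_range] at hi
    obtain ⟨hi, c, hc⟩ := hi
    have hc0 : 0 < c := by rcases Nat.eq_zero_or_pos c with rfl | h; · omega
                           · exact h
    rw [hc, Nat.mul_div_cancel_left _ he, Nat.sub_add_cancel hc0, mul_comm]; omega
  · intro j hj
    have : 0 < (j + 1) * e := by positivity
    rw [Nat.sub_add_cancel this]

open Classical in
lemma zeta_rec (S : ℕ → Finset (Ideal R)) (hS : ∀ d I, I ∈ S d ↔ I ≠ ⊥ ∧ ideg k I = d)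
    (d : ℕ) (PP : Finset (Ideal R))
    (hPP : ∀ P, P ∈ PP ↔ P.IsMaximal ∧ P ≠ ⊥ ∧ ideg k P ≤ d) :
    d * (S d).card = ∑ i ∈ Finset.range d,
      (∑ P ∈ PP, if ideg k P ∣ i + 1 then ideg k P else 0) * (S (d - (i + 1))).card := by
  have hcount : ∀ P ∈ PP, ∀ j, ((S d).filter (fun I => P ^ (j + 1) ∣ I)).card =
      if (j + 1) * ideg k P ≤ d then (S (d - (j + 1) * ideg k P)).card else 0 := by
    intro P hP j
    obtain ⟨hPm, hP0, -⟩ := (hPP P).mp hP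
    have hQ0 : P ^ (j + 1) ≠ ⊥ := pow_ne_zero (M₀ := Ideal R) _ hP0
    split_ifs with hj
    · have : (S d).filter (fun I => P ^ (j + 1) ∣ I) =
        (S (d - (j + 1) * ideg k P)).image (fun J => P ^ (j + 1) * J) := by
        ext I
        rw [Finset.mem_filter, Finset.mem_image, hS]
        constructor
        · rintro ⟨⟨hI, hId⟩, J, rfl⟩
          have hJ : J ≠ ⊥ := right_ne_zero_of_mul hI
          refine ⟨J, ?_, rfl⟩
          rw [hS]
          rw [ideg_mul k hfin hQ0 hJ, ideg_pow k hfin hP0] at hId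
          exact ⟨hJ, by omega⟩
        · rintro ⟨J, hJ, rfl⟩
          rw [hS] at hJ
          refine ⟨⟨mul_ne_zero hQ0 hJ.1, ?_⟩, dvd_mul_right _ _⟩
          rw [ideg_mul k hfin hQ0 hJ.1, ideg_pow k hfin hP0]
          omega
      rw [this, Finset.card_image_of_injective]
      exact mul_right_injective₀ hQ0
    · rw [Finset.card_eq_zero, Finset.filter_eq_empty_iff]
      rintro I hI ⟨J, rfl⟩
      rw [hS] at hI
      obtain ⟨hI, hId⟩ := hI
      have hJ : J ≠ ⊥ := right_ne_zero_of_mul hI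
      rw [ideg_mul k hfin hQ0 hJ, ideg_pow k hfin hP0] at hId
      omega
  calc d * (S d).card = ∑ I ∈ S d, d := by rw [Finset.sum_const, smul_eq_mul, mul_comm]
    _ = ∑ I ∈ S d, ∑ P ∈ PP, ∑ j ∈ Finset.range d, if P ^ (j + 1) ∣ I then ideg k P else 0 := by
      refine Finset.sum_congr rfl fun I hI => ?_
      rw [hS] at hI
      exact ideg_eq_sum k hfin PP hPP I hI.1 hI.2
    _ = ∑ P ∈ PP, ∑ j ∈ Finset.range d, ∑ I ∈ S d, if P ^ (j + 1) ∣ I then ideg k P else 0 := by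
      rw [Finset.sum_comm]
      refine Finset.sum_congr rfl fun P hP => ?_
      rw [Finset.sum_comm]
    _ = ∑ P ∈ PP, ideg k P * ∑ j ∈ Finset.range d,
          (if (j + 1) * ideg k P ≤ d then (S (d - (j + 1) * ideg k P)).card else 0) := by
      refine Finset.sum_congr rfl fun P hP => ?_
      rw [Finset.mul_sum]
      refine Finset.sum_congr rfl fun j _ => ?_
      rw [← Finset.sum_filter, Finset.sum_const, hcount P hP, smul_eq_mul, mul_comm]
    _ = ∑ P ∈ PP, ideg k P * ∑ i ∈ Finset.range d,
          (if ideg k P ∣ i + 1 then (S (d - (i + 1))).card else 0) := by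
      refine Finset.sum_congr rfl fun P hP => ?_
      obtain ⟨hPm, hP0, -⟩ := (hPP P).mp hP
      rw [reindex_sum (fun n => (S n).card) _ _ (ideg_pos k hfin hP0 hPm.ne_top)]
    _ = _ := by
      simp only [Finset.mul_sum, Finset.sum_mul]
      rw [Finset.sum_comm]
      refine Finset.sum_congr rfl fun i _ => Finset.sum_congr rfl fun P _ => ?_
      split_ifs <;> simp

open Classical in
lemma card_algHom_eq [Finite k] [Infinite R] {F : Type*} [Field F] [Algebra k F] [Finite F]
    (D : ℕ) (hD : Module.finrank k F ≤ D) (PP : Finset (Ideal R))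
    (hPP : ∀ P, P ∈ PP ↔ P.IsMaximal ∧ P ≠ ⊥ ∧ ideg k P ≤ D) :
    Nat.card (R →ₐ[k] F) = ∑ P ∈ PP, if ideg k P ∣ Module.finrank k F then ideg k P else 0 := by
  have : Module.Finite k F := Module.Finite.of_finite
  have hkm : ∀ φ : R →ₐ[k] F, (RingHom.ker φ).IsMaximal ∧ RingHom.ker φ ≠ ⊥ := by
    intro φ
    have hb : RingHom.ker φ ≠ ⊥ := by
      intro h
      have := (RingHom.injective_iff_ker_eq_bot φ.toRingHom).mpr h
      exact not_finite_iff_infinite.mpr ‹Infinite R› (Finite.of_injective _ this)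
    have : (RingHom.ker φ).IsPrime := RingHom.ker_isPrime φ.toRingHom
    exact ⟨this.isMaximal hb, hb⟩
  let e : ∀ P : Ideal R, P.IsMaximal → ({φ : R →ₐ[k] F // RingHom.ker φ = P} ≃ ((R ⧸ P) →ₐ[k] F)) := fun P hP =>
    { toFun := fun φ => Ideal.Quotient.liftₐ P φ.1 (fun a ha => by rw [← φ.2] at ha; exact ha)
      invFun := fun ψ => ⟨ψ.comp (Ideal.Quotient.mkₐ k P), by
        let := Ideal.Quotient.field P
        ext x
        rw [RingHom.mem_ker]
        change ψ (Ideal.Quotient.mk P x) = 0 ↔ _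
        rw [map_eq_zero_iff ψ (RingHom.injective ψ.toRingHom), Ideal.Quotient.eq_zero_iff_mem]⟩
      left_inv := fun φ => by
        apply Subtype.ext
        ext x
        rfl
      right_inv := fun ψ => by
        ext x
        obtain ⟨x, rfl⟩ := Ideal.Quotient.mk_surjective x
        rfl }
  have hmem : ∀ φ : R →ₐ[k] F, RingHom.ker φ ∈ PP := by
    intro φ
    obtain ⟨h1, h2⟩ := hkm φ
    rw [hPP]
    refine ⟨h1, h2, le_trans ?_ hD⟩
    let := Ideal.Quotient.field (RingHom.ker φ)
    have := e _ h1 ⟨φ, rfl⟩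
    exact LinearMap.finrank_le_finrank_of_injective (f := this.toLinearMap)
      (RingHom.injective this.toRingHom)
  have hfib : ∀ P ∈ PP, Finite {φ : R →ₐ[k] F // RingHom.ker φ = P} ∧
      Nat.card {φ : R →ₐ[k] F // RingHom.ker φ = P} = if ideg k P ∣ Module.finrank k F then ideg k P else 0 := by
    intro P hP
    obtain ⟨hPm, hP0, -⟩ := (hPP P).mp hP
    have := hfin P hP0
    have : Finite (R ⧸ P) := Module.finite_of_finite k
    let := Ideal.Quotient.field P
    have : Finite ((R ⧸ P) →ₐ[k] F) := Finite.of_injective (fun f => (f : (R ⧸ P) → F)) DFunLike.coe_injective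
    refine ⟨Finite.of_equiv _ (e P hPm).symm, ?_⟩
    rw [Nat.card_congr (e P hPm)]
    split_ifs with h
    · exact FiniteField.natCard_algHom_of_finrank_dvd h
    · rw [Nat.card_eq_zero]
      left
      rw [← not_nonempty_iff]
      intro hne
      exact h (FiniteField.nonempty_algHom_iff_finrank_dvd.mp hne)
  rw [Nat.card_congr (Equiv.sigmaFiberEquiv (fun φ : R →ₐ[k] F => (⟨RingHom.ker φ, hmem φ⟩ : PP))).symm]
  have h7 : ∀ P : PP, {φ : R →ₐ[k] F // (⟨RingHom.ker φ, hmem φ⟩ : PP) = P} ≃ {φ : R →ₐ[k] F // RingHom.ker φ = P.1} :=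
    fun P => Equiv.subtypeEquivRight (fun φ => Subtype.ext_iff)
  have : ∀ P : PP, Finite {φ : R →ₐ[k] F // (⟨RingHom.ker φ, hmem φ⟩ : PP) = P} := fun P => by
    have := (hfib P.1 P.2).1
    exact Finite.of_equiv _ (h7 P).symm
  rw [Nat.card_sigma, ← Finset.sum_coe_sort PP (fun P => if ideg k P ∣ Module.finrank k F then ideg k P else 0)]
  refine Finset.sum_congr rfl fun P _ => ?_
  rw [Nat.card_congr (h7 P), (hfib P.1 P.2).2]

end Zeta

set_option linter.unusedSectionVars false
set_option linter.style.haveILetI false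

section ClassNumber
open nonZeroDivisors
variable (k : Type*) {R : Type*} [Field k] [Finite k] [CommRing R] [Algebra k R] [IsDedekindDomain R]

lemma finite_ideals (hfin : ∀ I : Ideal R, I ≠ ⊥ → Module.Finite k (R ⧸ I))
    (t : R) (ht : ∀ i j : ℕ, i < j → t ^ j ≠ t ^ i) (D : ℕ) :
    {I : Ideal R | I ≠ ⊥ ∧ ideg k I ≤ D}.Finite := by
  set Q := Nat.card k ^ D with hQ
  set G : R := ∏ j ∈ Finset.range (Q + 1), ∏ i ∈ Finset.range j, (t ^ j - t ^ i) with hG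
  have hG0 : G ≠ 0 := by
    rw [hG, Finset.prod_ne_zero_iff]
    intro j _
    rw [Finset.prod_ne_zero_iff]
    intro i hi
    exact sub_ne_zero.mpr (ht i j (Finset.mem_range.mp hi))
  have hG0' : Ideal.span {G} ≠ (0 : Ideal R) := by
    rw [Ne, Ideal.zero_eq_bot, Ideal.span_singleton_eq_bot]; exact hG0
  have hf := UniqueFactorizationMonoid.fintypeSubtypeDvd (Ideal.span {G}) hG0'
  have hf' : {I : Ideal R | I ∣ Ideal.span {G}}.Finite :=
    @Set.toFinite _ _ (@Finite.of_fintype _ hf)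
  refine hf'.subset ?_
  rintro I ⟨hI, hID⟩
  change I ∣ _
  rw [Ideal.dvd_iff_le, Ideal.span_singleton_le_iff_mem]
  have := hfin I hI
  have : Finite (R ⧸ I) := Module.finite_of_finite k
  have hcard : Nat.card (R ⧸ I) ≤ Q := by
    rw [Module.natCard_eq_pow_finrank (K := k)]
    exact Nat.pow_le_pow_right Nat.card_pos hID
  have hni : ¬ Function.Injective (fun i : Fin (Q + 1) => Ideal.Quotient.mk I (t ^ i.1)) := by
    intro h
    have := Nat.card_le_card_of_injective _ h
    rw [Nat.card_fin] at this
    omega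
  rw [Function.not_injective_iff] at hni
  have key : ∀ i j : Fin (Q + 1), i < j → Ideal.Quotient.mk I (t ^ i.1) = Ideal.Quotient.mk I (t ^ j.1) → G ∈ I := by
    intro i j hij h
    have h1 : t ^ j.1 - t ^ i.1 ∈ I := Ideal.Quotient.eq.mp h.symm
    refine Ideal.mem_of_dvd I ?_ h1
    refine dvd_trans ?_ (Finset.dvd_prod_of_mem _ (Finset.mem_range.mpr j.2))
    exact Finset.dvd_prod_of_mem (fun i => t ^ j.1 - t ^ i) (Finset.mem_range.mpr hij)
  obtain ⟨i, j, hij, hne⟩ := hni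
  rcases lt_or_gt_of_ne hne with h | h
  · exact key i j h hij
  · exact key j i h hij.symm

variable (hfin : ∀ I : Ideal R, I ≠ ⊥ → Module.Finite k (R ⧸ I))
  (V : ℕ → Submodule k R) (hV : ∀ z : R, z ≠ 0 → ∀ M, z ∈ V M ↔ ideg k (Ideal.span {z}) ≤ M)
  (g M0 : ℕ) (hdim : ∀ M ≥ M0, Module.Finite k (V M) ∧ Module.finrank k (V M) + g = M + 1)
  (hV0 : ∀ z ∈ V 0, ∃ c : k, algebraMap k R c = z)
include hfin hV

lemma exists_cofactor {I : Ideal R} (hI : I ≠ ⊥) {z : R} (hz : z ∈ I) (hz0 : z ≠ 0) :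
    ∃ J : (Ideal R)⁰, Ideal.span {z} = I * J ∧ ∀ D, z ∈ V (D + ideg k I) ↔ ideg k (J : Ideal R) ≤ D := by
  obtain ⟨J, hJ⟩ := Ideal.dvd_iff_le.mpr ((Ideal.span_singleton_le_iff_mem I).mpr hz)
  have h0 : I * J ≠ ⊥ := by rw [← hJ, Ne, Ideal.span_singleton_eq_bot]; exact hz0
  have hJ0 : J ≠ ⊥ := right_ne_zero_of_mul h0
  refine ⟨⟨J, mem_nonZeroDivisors_of_ne_zero hJ0⟩, hJ, fun D => ?_⟩
  rw [hV z hz0, hJ, ideg_mul k hfin hI hJ0]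
  simp only
  omega

include hV0 in
lemma fibre_count (I J : (Ideal R)⁰) (hIJ : ClassGroup.mk0 J = (ClassGroup.mk0 I)⁻¹) :
    Nat.card {z : R // Ideal.span {z} = (I : Ideal R) * (J : Ideal R)} = Nat.card k - 1 := by
  obtain ⟨x, hx0, hx⟩ := ClassGroup.mk0_eq_mk0_inv_iff.mp hIJ
  rw [mul_comm] at hx
  rw [← Nat.card_units k, hx]
  symm
  have hspan : ∀ c : kˣ, Ideal.span {algebraMap k R c * x} = Ideal.span {x} := fun c =>
    Ideal.span_singleton_mul_left_unit (c.isUnit.map (algebraMap k R)) x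
  refine Nat.card_eq_of_bijective (fun c : kˣ => ⟨algebraMap k R c * x, hspan c⟩) ⟨?_, ?_⟩
  · intro c c' h
    have h2 : algebraMap k R c * x = algebraMap k R c' * x := congrArg (fun w => w.1) h
    exact Units.ext ((algebraMap k R).injective (mul_right_cancel₀ hx0 h2))
  · rintro ⟨z, hz⟩
    rw [Ideal.span_singleton_eq_span_singleton] at hz
    obtain ⟨u, hu⟩ := hz.symm
    have hu0 : (u : R) ∈ V 0 := by
      rw [hV _ u.ne_zero, Ideal.span_singleton_eq_top.mpr u.isUnit, ideg_top k hfin]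
    obtain ⟨c, hc⟩ := hV0 _ hu0
    have hc0 : c ≠ 0 := by rintro rfl; rw [map_zero] at hc; exact u.ne_zero hc.symm
    refine ⟨Units.mk0 c hc0, ?_⟩
    apply Subtype.ext
    change algebraMap k R c * x = _
    rw [hc, mul_comm, hu]

include hdim

lemma exists_small_rep (C : ClassGroup R) :
    ∃ J : (Ideal R)⁰, ideg k (J : Ideal R) ≤ g + M0 ∧ ClassGroup.mk0 J = C := by
  obtain ⟨I, hI⟩ := ClassGroup.mk0_surjective C⁻¹
  have hI0 : (I : Ideal R) ≠ ⊥ := nonZeroDivisors.coe_ne_zero I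
  set M := (g + M0) + ideg k (I : Ideal R) with hM
  obtain ⟨h1, h2⟩ := hdim M (by omega)
  have := hfin I hI0
  let φ : V M →ₗ[k] (R ⧸ (I : Ideal R)) := (Ideal.Quotient.mkₐ k (I : Ideal R)).toLinearMap.comp (V M).subtype
  have hker : LinearMap.ker φ ≠ ⊥ := by
    apply LinearMap.ker_ne_bot_of_finrank_lt
    have h3 : ideg k (I : Ideal R) = Module.finrank k (R ⧸ (I : Ideal R)) := rfl
    omega
  obtain ⟨⟨z, hzV⟩, hz, hz0⟩ := (Submodule.ne_bot_iff _).mp hker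
  have hz0' : z ≠ 0 := fun h => hz0 (Subtype.ext h)
  have hzI : z ∈ (I : Ideal R) := Ideal.Quotient.eq_zero_iff_mem.mp hz
  obtain ⟨J, hJ, hJd⟩ := exists_cofactor k hfin V hV hI0 hzI hz0'
  refine ⟨J, (hJd _).mp hzV, ?_⟩
  rw [← inv_inv C, ← hI, ClassGroup.mk0_eq_mk0_inv_iff]
  exact ⟨z, hz0', by rw [hJ, mul_comm]⟩

lemma card_inter {I : Ideal R} (hI : I ≠ ⊥) :
    ∃ D0, ∀ D ≥ D0, Finite {z : R // z ∈ V (D + ideg k I) ∧ z ∈ I} ∧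
      Nat.card {z : R // z ∈ V (D + ideg k I) ∧ z ∈ I} = Nat.card k ^ (D + 1 - g) := by
  have := hfin I hI
  have : Finite (R ⧸ I) := Module.finite_of_finite k
  have := Fintype.ofFinite (R ⧸ I)
  let s : R ⧸ I → R := Function.surjInv Ideal.Quotient.mk_surjective
  have hs : ∀ y, Ideal.Quotient.mk I (s y) = y := Function.surjInv_eq _
  refine ⟨M0 + Finset.univ.sup (fun y => ideg k (Ideal.span {s y})), fun D hD => ?_⟩
  set M := D + ideg k I with hM
  obtain ⟨h1, h2⟩ := hdim M (by omega)
  let φ : V M →ₗ[k] (R ⧸ I) := (Ideal.Quotient.mkₐ k I).toLinearMap.comp (V M).subtype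
  have hφ : LinearMap.range φ = ⊤ := by
    rw [LinearMap.range_eq_top]
    intro y
    have hmem : s y ∈ V M := by
      by_cases h0 : s y = 0
      · rw [h0]; exact zero_mem _
      · rw [hV _ h0]
        have := Finset.le_sup (f := fun y => ideg k (Ideal.span {s y})) (Finset.mem_univ y)
        omega
    exact ⟨⟨s y, hmem⟩, hs y⟩
  have hrn := LinearMap.finrank_range_add_finrank_ker φ
  rw [hφ, finrank_top] at hrn
  let e : LinearMap.ker φ ≃ {z : R // z ∈ V M ∧ z ∈ I} :=
    { toFun := fun z => ⟨z.1.1, z.1.2, Ideal.Quotient.eq_zero_iff_mem.mp z.2⟩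
      invFun := fun z => ⟨⟨z.1, z.2.1⟩, Ideal.Quotient.eq_zero_iff_mem.mpr z.2.2⟩
      left_inv := fun z => rfl
      right_inv := fun z => rfl }
  have hfk : Finite (LinearMap.ker φ) := Module.finite_of_finite k
  refine ⟨Finite.of_equiv _ e, ?_⟩
  rw [← Nat.card_congr e, Module.natCard_eq_pow_finrank (K := k)]
  congr 1
  have h3 : ideg k I = Module.finrank k (R ⧸ I) := rfl
  omega

include hV0

set_option maxHeartbeats 1000000 in
lemma class_count (C : ClassGroup R)
    (hT : ∀ D, Finite {J : (Ideal R)⁰ // ideg k (J : Ideal R) ≤ D ∧ ClassGroup.mk0 J = C}) :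
    ∃ D0, ∀ D ≥ D0,
      Nat.card {J : (Ideal R)⁰ // ideg k (J : Ideal R) ≤ D ∧ ClassGroup.mk0 J = C} * (Nat.card k - 1) + 1
        = Nat.card k ^ (D + 1 - g) := by
  obtain ⟨I, hI⟩ := ClassGroup.mk0_surjective C⁻¹
  have hI0 : (I : Ideal R) ≠ ⊥ := nonZeroDivisors.coe_ne_zero I
  obtain ⟨D0, hD0⟩ := card_inter k hfin V hV g M0 hdim hI0
  refine ⟨D0, fun D hD => ?_⟩
  obtain ⟨hf, hc⟩ := hD0 D hD
  rw [← hc]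
  set M := D + ideg k (I : Ideal R) with hM
  set Z := {z : R // z ∈ V M ∧ z ∈ (I : Ideal R)}
  let z0 : Z := ⟨0, zero_mem _, zero_mem _⟩
  have hone : Nat.card Z = Nat.card {z : Z // z ≠ z0} + 1 := by
    have := Fintype.ofFinite Z
    classical
    rw [Nat.card_eq_fintype_card, Nat.card_eq_fintype_card, Fintype.card_subtype_compl, Fintype.card_subtype_eq]
    have : 0 < Fintype.card Z := Fintype.card_pos_iff.mpr ⟨z0⟩
    omega
  rw [hone]
  congr 1
  set T := {J : (Ideal R)⁰ // ideg k (J : Ideal R) ≤ D ∧ ClassGroup.mk0 J = C}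
  have := hT D
  have := Fintype.ofFinite T
  have hex : ∀ z : {z : Z // z ≠ z0}, ∃ J : T, Ideal.span {z.1.1} = (I : Ideal R) * (J.1 : Ideal R) := by
    rintro ⟨⟨z, hzV, hzI⟩, hz⟩
    have hz0' : z ≠ 0 := fun h => hz (Subtype.ext h)
    obtain ⟨J, hJ, hJd⟩ := exists_cofactor k hfin V hV hI0 hzI hz0'
    refine ⟨⟨J, (hJd _).mp hzV, ?_⟩, hJ⟩
    rw [← inv_inv C, ← hI, ClassGroup.mk0_eq_mk0_inv_iff]
    exact ⟨z, hz0', by rw [hJ, mul_comm]⟩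
  choose ψ hψ using hex
  rw [Nat.card_congr (Equiv.sigmaFiberEquiv ψ).symm, Nat.card_sigma]
  have hfib : ∀ J : T, Nat.card {z // ψ z = J} = Nat.card k - 1 := by
    intro J
    have hJC : ClassGroup.mk0 J.1 = (ClassGroup.mk0 I)⁻¹ := by rw [hI, inv_inv]; exact J.2.2
    have hJD := J.2.1
    have hJ0 : (J.1 : Ideal R) ≠ ⊥ := nonZeroDivisors.coe_ne_zero J.1
    rw [← fibre_count k hfin V hV hV0 I J.1 hJC]
    have hz0 : ∀ z : R, Ideal.span {z} = (I : Ideal R) * (J.1 : Ideal R) → z ≠ 0 := by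
      rintro z hz rfl
      rw [Ideal.span_singleton_eq_bot.mpr rfl] at hz
      exact mul_ne_zero hI0 hJ0 hz.symm
    have hzI : ∀ z : R, Ideal.span {z} = (I : Ideal R) * (J.1 : Ideal R) → z ∈ (I : Ideal R) := by
      intro z hz
      have : z ∈ (I : Ideal R) * (J.1 : Ideal R) := by rw [← hz]; exact Ideal.mem_span_singleton_self z
      exact Ideal.mul_le_left this
    have hzV : ∀ z : R, Ideal.span {z} = (I : Ideal R) * (J.1 : Ideal R) → z ∈ V M := by
      intro z hz
      rw [hV _ (hz0 z hz), hz, ideg_mul k hfin hI0 hJ0]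
      omega
    refine Nat.card_congr ⟨fun z => ⟨z.1.1.1, by rw [hψ z.1, z.2]⟩,
      fun z => ⟨⟨⟨z.1, hzV _ z.2, hzI _ z.2⟩, fun h => hz0 _ z.2 (congrArg (fun w => w.1) h)⟩, ?_⟩, fun _ => rfl, fun _ => rfl⟩
    have h2 := hψ ⟨⟨z.1, hzV _ z.2, hzI _ z.2⟩, fun h => hz0 _ z.2 (congrArg (fun w => w.1) h)⟩
    have h3 := z.2.symm.trans h2
    exact Subtype.ext (Subtype.ext (mul_left_cancel₀ hI0 h3).symm)
  rw [Finset.sum_congr rfl (fun J _ => hfib J), Finset.sum_const, Finset.card_univ, smul_eq_mul, Nat.card_eq_fintype_card]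

theorem class_number_formula (t : R) (ht : ∀ i j : ℕ, i < j → t ^ j ≠ t ^ i)
    (S : ℕ → Finset (Ideal R)) (hS : ∀ d I, I ∈ S d ↔ I ≠ ⊥ ∧ ideg k I = d) :
    Nat.card (ClassGroup R) ≠ 0 ∧
    ∃ D0, ∀ D ≥ D0, ∑ d ∈ Finset.range (D + 2), (S d).card =
      Nat.card (ClassGroup R) + Nat.card k * ∑ d ∈ Finset.range (D + 1), (S d).card := by
  have hfinT : ∀ D, Finite {J : (Ideal R)⁰ // ideg k (J : Ideal R) ≤ D} := by
    intro D
    have := (finite_ideals k hfin t ht D).to_subtype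
    refine Finite.of_injective (β := {I : Ideal R | I ≠ ⊥ ∧ ideg k I ≤ D})
      (fun J => ⟨J.1.1, nonZeroDivisors.coe_ne_zero J.1, J.2⟩) ?_
    intro J J' h
    exact Subtype.ext (Subtype.ext (congrArg (fun w => w.1) h))
  have hcl : Finite (ClassGroup R) := by
    have := hfinT (g + M0)
    refine Finite.of_surjective (fun J : {J : (Ideal R)⁰ // ideg k (J : Ideal R) ≤ g + M0} => ClassGroup.mk0 J.1) ?_
    intro C
    obtain ⟨J, hJ, hJC⟩ := exists_small_rep k hfin V hV g M0 hdim C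
    exact ⟨⟨J, hJ⟩, hJC⟩
  refine ⟨Nat.card_pos.ne', ?_⟩
  have hT : ∀ C D, Finite {J : (Ideal R)⁰ // ideg k (J : Ideal R) ≤ D ∧ ClassGroup.mk0 J = C} := by
    intro C D
    have := hfinT D
    exact Finite.of_injective (β := {J : (Ideal R)⁰ // ideg k (J : Ideal R) ≤ D}) (fun J => ⟨J.1, J.2.1⟩)
      (fun J J' h => Subtype.ext (congrArg (fun w => w.1) h))
  choose D0 hD0 using fun C => class_count k hfin V hV g M0 hdim hV0 C (hT C)
  have := Fintype.ofFinite (ClassGroup R)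
  have htot : ∀ D ≥ Finset.univ.sup D0,
      (∑ d ∈ Finset.range (D + 1), (S d).card) * (Nat.card k - 1) + Nat.card (ClassGroup R)
        = Nat.card (ClassGroup R) * Nat.card k ^ (D + 1 - g) := by
    intro D hD
    have h1 : ∑ d ∈ Finset.range (D + 1), (S d).card = Nat.card {J : (Ideal R)⁰ // ideg k (J : Ideal R) ≤ D} := by
      classical
      rw [← Finset.card_biUnion]
      · rw [← Nat.subtype_card (p := fun J : Ideal R => J ≠ ⊥ ∧ ideg k J ≤ D)]
        · refine Nat.card_congr ⟨fun J => ⟨⟨J.1, mem_nonZeroDivisors_of_ne_zero J.2.1⟩, J.2.2⟩,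
            fun J => ⟨J.1.1, nonZeroDivisors.coe_ne_zero J.1, J.2⟩, fun _ => rfl, fun _ => rfl⟩
        · intro I
          simp only [Finset.mem_biUnion, Finset.mem_range, hS]
          constructor
          · rintro ⟨d, hd, h, h'⟩; exact ⟨h, by omega⟩
          · rintro ⟨h, h'⟩; exact ⟨_, by omega, h, rfl⟩
      · intro i _ j _ hij
        rw [Function.onFun, Finset.disjoint_left]
        intro I hi hj
        rw [hS] at hi hj
        exact hij (hi.2.symm.trans hj.2)
    have h2 : Nat.card {J : (Ideal R)⁰ // ideg k (J : Ideal R) ≤ D} =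
        ∑ C : ClassGroup R, Nat.card {J : (Ideal R)⁰ // ideg k (J : Ideal R) ≤ D ∧ ClassGroup.mk0 J = C} := by
      have := hT
      rw [← Nat.card_sigma]
      refine Nat.card_congr ⟨fun J => ⟨ClassGroup.mk0 J.1, J.1, J.2, rfl⟩, fun J => ⟨J.2.1, J.2.2.1⟩, fun _ => rfl, ?_⟩
      rintro ⟨C, J, h, rfl⟩
      rfl
    have h3 : Nat.card (ClassGroup R) = ∑ C : ClassGroup R, 1 := by simp
    rw [h1, h2, Finset.sum_mul]
    nth_rewrite 1 [h3]
    rw [← Finset.sum_add_distrib, Finset.sum_congr rfl (fun C _ => hD0 C D (le_trans (Finset.le_sup (Finset.mem_univ C)) hD))]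
    simp
  refine ⟨Finset.univ.sup D0 + g, fun D hD => ?_⟩
  have e1 := htot D (by omega)
  have e2 := htot (D + 1) (by omega)
  have hq : 1 < Nat.card k := Finite.one_lt_card
  obtain ⟨r, hr⟩ : ∃ r, Nat.card k = r + 2 := ⟨Nat.card k - 2, by omega⟩
  rw [show D + 1 + 1 - g = (D + 1 - g) + 1 by omega, pow_succ] at e2
  rw [hr] at e1 e2 ⊢
  simp only [show r + 2 - 1 = r + 1 by omega] at e1 e2
  have : (r + 1) * (∑ d ∈ Finset.range (D + 2), (S d).card) = (r + 1) * (Nat.card (ClassGroup R) + (r + 2) * ∑ d ∈ Finset.range (D + 1), (S d).card) := by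
    zify at e1 e2 ⊢
    linear_combination e2 - (r + 2 : ℤ) * e1
  exact Nat.eq_of_mul_eq_mul_left (by omega) this

end ClassNumber

set_option linter.unusedSectionVars false
set_option linter.style.haveILetI false

lemma dvd_of_isIntegral_div {A L : Type*} [CommRing A] [IsDomain A] [IsIntegrallyClosed A] [Field L]
    [Algebra A L] [FaithfulSMul A L] {a c : A} (hc : c ≠ 0)
    (h : IsIntegral A (algebraMap A L a / algebraMap A L c)) : c ∣ a := by
  letI := FractionRing.liftAlgebra A L
  have h1 : algebraMap A L a / algebraMap A L c =
      algebraMap (FractionRing A) L (algebraMap A (FractionRing A) a / algebraMap A (FractionRing A) c) := by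
    rw [map_div₀, ← IsScalarTower.algebraMap_apply, ← IsScalarTower.algebraMap_apply]
  rw [h1, isIntegral_algebraMap_iff (algebraMap (FractionRing A) L).injective] at h
  obtain ⟨y, hy⟩ := IsIntegrallyClosed.isIntegral_iff.mp h
  have hc' : algebraMap A (FractionRing A) c ≠ 0 := by
    rwa [Ne, IsFractionRing.to_map_eq_zero_iff]
  rw [eq_div_iff hc', ← map_mul] at hy
  exact ⟨y, by rw [mul_comm]; exact (IsFractionRing.injective A (FractionRing A) hy).symm⟩

lemma dvd_of_sq_dvd_squarefree_mul {A : Type*} [CommRing A] [IsDomain A] [IsPrincipalIdealRing A] {f b c : A}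
    (hf : Squarefree f) (hb : b ≠ 0) (h : c ^ 2 ∣ f * b ^ 2) : c ∣ b := by
  obtain ⟨b', c', d, hrel, hb', hc'⟩ := UniqueFactorizationMonoid.exists_reduced_factors b hb c
  have hd : d ≠ 0 := by rintro rfl; simp at hb'; exact hb hb'.symm
  rw [← hb', ← hc', mul_pow, mul_pow, mul_left_comm, mul_dvd_mul_iff_left (pow_ne_zero 2 hd)] at h
  have hcop : IsCoprime (c' ^ 2) (b' ^ 2) := (hrel.isCoprime.symm).pow
  have h2 : c' * c' ∣ f := by rw [← pow_two]; exact hcop.dvd_of_dvd_mul_right h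
  have hu : IsUnit c' := hf c' h2
  rw [← hb', ← hc']
  exact mul_dvd_mul_left d hu.dvd

section Concrete
variable {k : Type*} [Field k] [Finite k] {R : Type*} [CommRing R] [IsDomain R] [Algebra k R]
  [Algebra k[X] R] [IsScalarTower k k[X] R] (B : Module.Basis (Fin 2) k[X] R) (hB0 : B 0 = 1)
  (f : k[X]) (hB1 : B 1 ^ 2 = algebraMap k[X] R f)

include B in
lemma quot_finite (I : Ideal R) (hI : I ≠ ⊥) : Module.Finite k (R ⧸ I) := by
  exact Module.Finite.equiv (I.quotientEquivDirectSum k B hI).symm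

include B in
lemma inj_algMap : Function.Injective (algebraMap k[X] R) := by
  have := Module.Free.of_basis B
  exact FaithfulSMul.algebraMap_injective _ _

include hB0 in
lemma repr_eq (z : R) : z = algebraMap k[X] R (B.repr z 0) + algebraMap k[X] R (B.repr z 1) * B 1 := by
  conv_lhs => rw [← B.sum_repr z]
  rw [Fin.sum_univ_two, hB0, Algebra.smul_def, Algebra.smul_def, mul_one]

include hB0 hB1 in
lemma norm_formula (z : R) :
    Algebra.norm k[X] z = (B.repr z 0) ^ 2 - f * (B.repr z 1) ^ 2 := by
  have h1 : z * B 1 = (f * B.repr z 1) • B 0 + (B.repr z 0) • B 1 := by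
    conv_lhs => rw [repr_eq B hB0 z]
    rw [hB0, Algebra.smul_def, Algebra.smul_def, map_mul, ← hB1]
    ring
  rw [Algebra.norm_eq_matrix_det B, Matrix.det_fin_two]
  simp only [Algebra.leftMulMatrix_eq_repr_mul]
  rw [h1, hB0, mul_one, map_add, map_smul, map_smul, ← hB0, B.repr_self, B.repr_self]
  simp
  ring


lemma deg_formula (hodd : Odd f.natDegree) (a b : k[X]) (hab : a ≠ 0 ∨ b ≠ 0) (M : ℕ) :
    (a ∈ degreeLT k (M / 2 + 1) ∧ b ∈ degreeLT k ((M + 2 - f.natDegree) / 2)) ↔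
      (a ^ 2 - f * b ^ 2).natDegree ≤ M := by
  have hf0 : f ≠ 0 := by rintro rfl; simp at hodd
  obtain ⟨g, hg⟩ := hodd
  have hmem : ∀ (c : k[X]) (n : ℕ), c ≠ 0 → (c ∈ degreeLT k n ↔ c.natDegree < n) := by
    intro c n hc
    rw [mem_degreeLT, natDegree_lt_iff_degree_lt hc]
  by_cases ha : a = 0
  · have hb : b ≠ 0 := by tauto
    subst ha
    rw [hmem _ _ hb]
    simp only [zero_mem, true_and, ne_eq, OfNat.ofNat_ne_zero, not_false_eq_true, zero_pow, zero_sub, natDegree_neg]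
    rw [natDegree_mul hf0 (pow_ne_zero 2 hb), natDegree_pow]
    omega
  by_cases hb : b = 0
  · subst hb
    rw [hmem _ _ ha]
    simp only [zero_mem, and_true, ne_eq, OfNat.ofNat_ne_zero, not_false_eq_true, zero_pow, mul_zero, sub_zero]
    rw [natDegree_pow]
    omega
  rw [hmem _ _ ha, hmem _ _ hb]
  have h1 : (a ^ 2).natDegree = 2 * a.natDegree := natDegree_pow _ _
  have h2 : (f * b ^ 2).natDegree = f.natDegree + 2 * b.natDegree := by
    rw [natDegree_mul hf0 (pow_ne_zero 2 hb), natDegree_pow]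
  rcases lt_or_gt_of_ne (show (a ^ 2).natDegree ≠ (f * b ^ 2).natDegree by omega) with h | h
  · rw [natDegree_sub_eq_right_of_natDegree_lt h]
    omega
  · rw [natDegree_sub_eq_left_of_natDegree_lt h]
    omega

/-- Functions with bounded pole order. -/
noncomputable def VV (M : ℕ) : Submodule k R :=
  ((degreeLT k (M / 2 + 1)).comap ((B.coord 0).restrictScalars k)) ⊓
  ((degreeLT k ((M + 2 - f.natDegree) / 2)).comap ((B.coord 1).restrictScalars k))

lemma mem_VV (M : ℕ) (z : R) : z ∈ VV B f M ↔
    (B.repr z 0 ∈ degreeLT k (M / 2 + 1) ∧ B.repr z 1 ∈ degreeLT k ((M + 2 - f.natDegree) / 2)) := Iff.rfl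

include hB0 hB1 in
lemma mem_VV_iff (hodd : Odd f.natDegree) (z : R) (hz : z ≠ 0) (M : ℕ) :
    z ∈ VV B f M ↔ ideg k (Ideal.span {z}) ≤ M := by
  rw [ideg, finrank_quotient_span_eq_natDegree_norm B hz, norm_formula B hB0 f hB1, mem_VV]
  apply deg_formula f hodd
  by_contra! h
  apply hz
  rw [repr_eq B hB0 z, h.1, h.2]
  simp

include hB0 in
lemma VV_zero (hodd : Odd f.natDegree) (z : R) (hz : z ∈ VV B f 0) : ∃ c : k, algebraMap k R c = z := by
  rw [mem_VV] at hz
  obtain ⟨h1, h2⟩ := hz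
  have hpos := hodd.pos
  rw [show (0 + 2 - f.natDegree) / 2 = 0 by omega, mem_degreeLT, Nat.cast_zero,
    Nat.WithBot.lt_zero_iff, degree_eq_bot] at h2
  rw [mem_degreeLT] at h1
  have h3 : (B.repr z 0).degree ≤ 0 := by
    have : (B.repr z 0).degree < 1 := by simpa using h1
    exact Nat.WithBot.lt_one_iff_le_zero.mp this
  refine ⟨(B.repr z 0).coeff 0, ?_⟩
  conv_rhs => rw [repr_eq B hB0 z, h2, eq_C_of_degree_le_zero h3]
  rw [IsScalarTower.algebraMap_apply k k[X] R]
  simp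

lemma VV_dim {g : ℕ} (hg : f.natDegree = 2 * g + 1) (M : ℕ) (hM : M ≥ 2 * g + 1) :
    Module.Finite k (VV B f M) ∧ Module.finrank k (VV B f M) + g = M + 1 := by
  let e : VV B f M ≃ₗ[k] degreeLT k (M / 2 + 1) × degreeLT k ((M + 2 - f.natDegree) / 2) :=
    { toFun := fun z => (⟨B.repr z 0, z.2.1⟩, ⟨B.repr z 1, z.2.2⟩)
      map_add' := fun z w => by ext <;> simp
      map_smul' := fun c z => by
        have : ∀ i, B.repr (c • (z : R)) i = c • B.repr z i := fun i => by
          rw [← algebraMap_smul k[X] c (z : R), map_smul]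
          simp [smul_eq_C_mul]
        ext <;> simp [this]
      invFun := fun w => ⟨w.1.1 • B 0 + w.2.1 • B 1, by
        rw [mem_VV]; simp⟩
      left_inv := fun z => by
        apply Subtype.ext
        conv_rhs => rw [← B.sum_repr z, Fin.sum_univ_two]
      right_inv := fun w => by ext <;> simp }
  have : Module.Finite k (degreeLT k (M / 2 + 1)) := Module.Finite.equiv (degreeLTEquiv k _).symm
  have : Module.Finite k (degreeLT k ((M + 2 - f.natDegree) / 2)) := Module.Finite.equiv (degreeLTEquiv k _).symm
  refine ⟨Module.Finite.equiv e.symm, ?_⟩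
  rw [e.finrank_eq, Module.finrank_prod, (degreeLTEquiv k _).finrank_eq, (degreeLTEquiv k _).finrank_eq]
  simp only [Module.finrank_fintype_fun_eq_card, Fintype.card_fin]
  omega

include B in
lemma X_pow_ne (i j : ℕ) (hij : i < j) : (algebraMap k[X] R X) ^ j ≠ (algebraMap k[X] R X) ^ i := by
  rw [← map_pow, ← map_pow]
  intro h
  have := congrArg natDegree (inj_algMap B h)
  rw [natDegree_X_pow, natDegree_X_pow] at this
  omega

include B hB0 hB1 in
lemma intClosed_aux (hf : Squarefree f) (h2 : (2 : k) ≠ 0) (σ : R →ₐ[k[X]] R) (hσ : σ (B 1) = - B 1)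
    (L : Type*) [Field L] [Algebra R L] [IsFractionRing R L] [Algebra k[X] L] [IsScalarTower k[X] R L]
    (z : L) (hz : IsIntegral R z) : ∃ y, algebraMap R L y = z := by
  have hfree := Module.Free.of_basis B
  have hfinite := Module.Finite.of_basis B
  have hinjL : Function.Injective (algebraMap R L) := IsFractionRing.injective R L
  have hz' : IsIntegral k[X] z := isIntegral_trans z hz
  have hinj := inj_algMap B
  have hFS : FaithfulSMul k[X] L := by
    rw [faithfulSMul_iff_algebraMap_injective, IsScalarTower.algebraMap_eq k[X] R L]
    exact hinjL.comp hinj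
  have hσz : ∀ a b : k[X], σ (algebraMap k[X] R a + algebraMap k[X] R b * B 1) =
      algebraMap k[X] R a - algebraMap k[X] R b * B 1 := by
    intro a b
    rw [map_add, map_mul, AlgHom.commutes, AlgHom.commutes, hσ]; ring
  have hσσ : ∀ w, σ (σ w) = w := by
    intro w
    rw [repr_eq B hB0 w, hσz, map_sub, map_mul, AlgHom.commutes, AlgHom.commutes, hσ]; ring
  have hσinj : Function.Injective σ := Function.LeftInverse.injective hσσ
  let g : R →ₐ[k[X]] L := (IsScalarTower.toAlgHom k[X] R L).comp σ
  have hg : Function.Injective g := hinjL.comp hσinj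
  let τ : L →ₐ[k[X]] L := IsFractionRing.liftAlgHom hg
  have hτ : ∀ r : R, τ (algebraMap R L r) = algebraMap R L (σ r) := fun r =>
    IsFractionRing.lift_algebraMap hg r
  -- write z = (a + b x) / c
  obtain ⟨u, v, hv, huv⟩ := IsFractionRing.div_surjective (A := R) z
  have hv0 : v ≠ 0 := nonZeroDivisors.ne_zero hv
  set c := Algebra.norm k[X] v with hc
  have hc0 : c ≠ 0 := by
    rw [hc]
    exact (Algebra.norm_ne_zero_iff (R := k[X])).mpr hv0
  have hcv : algebraMap k[X] R c = v * σ v := by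
    have e1 := repr_eq B hB0 v
    have e2 : σ v = algebraMap k[X] R (B.repr v 0) - algebraMap k[X] R (B.repr v 1) * B 1 := by
      conv_lhs => rw [e1]
      exact hσz _ _
    rw [e2, hc, norm_formula B hB0 f hB1, map_sub, map_mul, map_pow, map_pow, ← hB1]
    linear_combination -(algebraMap k[X] R (B.repr v 0) - algebraMap k[X] R (B.repr v 1) * B 1) * e1
  set w := u * σ v with hw
  have hσv0 : σ v ≠ 0 := fun h => hv0 (hσinj (by rw [h, map_zero]))
  obtain ⟨a, b, hwab⟩ : ∃ a b : k[X], w = algebraMap k[X] R a + algebraMap k[X] R b * B 1 :=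
    ⟨_, _, repr_eq B hB0 w⟩
  have hcL : algebraMap k[X] L c ≠ 0 := by
    rw [Ne, FaithfulSMul.algebraMap_eq_zero_iff]; exact hc0
  have hT : ∀ r : k[X], algebraMap k[X] L r = algebraMap R L (algebraMap k[X] R r) := fun r =>
    IsScalarTower.algebraMap_apply k[X] R L r
  have hzw : z * algebraMap k[X] L c = algebraMap R L w := by
    rw [← huv, hT, hcv, hw, map_mul, map_mul]
    have : algebraMap R L v ≠ 0 := fun h => hv0 (hinjL (by rw [h, map_zero]))
    field_simp
  have hτz : τ z * algebraMap k[X] L c = algebraMap R L (σ w) := by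
    have := congrArg τ hzw
    rwa [map_mul, AlgHom.commutes, hτ] at this
  have hτi : IsIntegral k[X] (τ z) := hz'.map τ
  have h1 : c ∣ 2 * a := by
    apply dvd_of_isIntegral_div (L := L) hc0
    suffices h : algebraMap k[X] L (2 * a) / algebraMap k[X] L c = z + τ z by
      rw [h]; exact hz'.add hτi
    rw [div_eq_iff hcL, add_mul, hzw, hτz, hwab, hσz, hT, ← map_add]
    congr 1
    rw [map_mul, map_ofNat]; ring
  have h3 : c ^ 2 ∣ 4 * (f * b ^ 2) := by
    apply dvd_of_isIntegral_div (L := L) (pow_ne_zero 2 hc0)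
    suffices h : algebraMap k[X] L (4 * (f * b ^ 2)) / algebraMap k[X] L (c ^ 2) = (z - τ z) ^ 2 by
      rw [h]; exact (hz'.sub hτi).pow 2
    rw [map_pow, div_eq_iff (pow_ne_zero 2 hcL), ← mul_pow, sub_mul, hzw, hτz, hwab, hσz, hT, ← map_sub, ← map_pow (algebraMap R L)]
    congr 1
    rw [map_mul, map_mul, map_ofNat, map_pow, ← hB1]; ring
  have hu2 : IsUnit (2 : k[X]) := by
    have := (isUnit_iff_ne_zero.mpr h2).map (C : k →+* k[X])
    rwa [map_ofNat] at this
  have hu4 : IsUnit (4 : k[X]) := by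
    have := hu2.mul hu2
    norm_num at this
    exact this
  have hca : c ∣ a := (hu2.dvd_mul_left).mp h1
  have hcb : c ∣ b := by
    by_cases hb0 : b = 0
    · rw [hb0]; exact dvd_zero c
    · exact dvd_of_sq_dvd_squarefree_mul hf hb0 ((hu4.dvd_mul_left).mp h3)
  obtain ⟨a', ha'⟩ := hca
  obtain ⟨b', hb'⟩ := hcb
  refine ⟨algebraMap k[X] R a' + algebraMap k[X] R b' * B 1, ?_⟩
  apply mul_right_cancel₀ hcL
  rw [hzw, hwab, ha', hb', hT, ← map_mul]
  congr 1
  rw [map_mul, map_mul]; ring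

include B hB0 hB1 in
lemma isDedekind (hf : Squarefree f) (h2 : (2 : k) ≠ 0) (σ : R →ₐ[k[X]] R) (hσ : σ (B 1) = - B 1) :
    IsDedekindDomain R := by
  have hfree := Module.Free.of_basis B
  have hfinite := Module.Finite.of_basis B
  have hnoeth : IsNoetherianRing R := IsNoetherianRing.of_finite k[X] R
  have hdim : Ring.DimensionLEOne R := ⟨fun {P} hP0 hP => by
    have := quot_finite B P hP0
    have : Finite (R ⧸ P) := Module.finite_of_finite k
    exact Ideal.Quotient.maximal_of_isField P (Finite.isField_of_domain _)⟩
  have hint : IsIntegrallyClosed R := by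
    let L := FractionRing R
    rw [isIntegrallyClosed_iff L]
    intro z hz
    exact intClosed_aux B hB0 f hB1 hf h2 σ hσ L z hz
  exact {}

end Concrete

set_option linter.unusedSectionVars false
set_option linter.style.haveILetI false

section Package
variable {k : Type*} [Field k] [Finite k] {R : Type*} [CommRing R] [IsDomain R] [Algebra k R]
  [Algebra k[X] R] [IsScalarTower k k[X] R] (B : Module.Basis (Fin 2) k[X] R) (hB0 : B 0 = 1)
  (f : k[X]) (hB1 : B 1 ^ 2 = algebraMap k[X] R f)

include hB0 hB1 in
theorem zeta_package (hf : Squarefree f) (hodd : Odd f.natDegree) (h2 : (2 : k) ≠ 0)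
    (σ : R →ₐ[k[X]] R) (hσ : σ (B 1) = - B 1)
    (N : ℕ → ℕ) (hN : ∀ s > 0, ∃ (F : Type) (_ : Field F) (_ : Algebra k F) (_ : Finite F),
      Module.finrank k F = s ∧ Nat.card (R →ₐ[k] F) = N s) :
    Nat.card (ClassGroup R) ≠ 0 ∧ ∃ a : ℕ → ℕ, a 0 = 1 ∧
      (∀ d, d * a d = ∑ i ∈ Finset.range d, N (i + 1) * a (d - (i + 1))) ∧
      ∃ D0, ∀ D ≥ D0, ∑ d ∈ Finset.range (D + 2), a d =
        Nat.card (ClassGroup R) + Nat.card k * ∑ d ∈ Finset.range (D + 1), a d := by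
  classical
  have hDed : IsDedekindDomain R := isDedekind B hB0 f hB1 hf h2 σ hσ
  have hfin : ∀ I : Ideal R, I ≠ ⊥ → Module.Finite k (R ⧸ I) := quot_finite B
  set t : R := algebraMap k[X] R X with ht
  have htp : ∀ i j : ℕ, i < j → t ^ j ≠ t ^ i := X_pow_ne B
  have hinf : Infinite R := Infinite.of_injective (fun i : ℕ => t ^ i) (by
    intro i j h
    by_contra hne
    rcases lt_or_gt_of_ne hne with h' | h'
    · exact htp i j h' h.symm
    · exact htp j i h' h)
  have hfi := finite_ideals k hfin t htp
  let S : ℕ → Finset (Ideal R) := fun d => (hfi d).toFinset.filter (fun I => ideg k I = d)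
  have hS : ∀ d I, I ∈ S d ↔ I ≠ ⊥ ∧ ideg k I = d := by
    intro d I
    simp only [S, Finset.mem_filter, Set.Finite.mem_toFinset]
    constructor
    · rintro ⟨⟨h, -⟩, h'⟩; exact ⟨h, h'⟩
    · rintro ⟨h, h'⟩; exact ⟨⟨h, h'.le⟩, h'⟩
  obtain ⟨g, hg⟩ := hodd
  obtain ⟨hcl, hD⟩ := class_number_formula k hfin (VV B f) (mem_VV_iff B hB0 f hB1 ⟨g, hg⟩) g (2 * g + 1)
    (fun M hM => VV_dim B f hg M hM) (VV_zero B hB0 f ⟨g, hg⟩) t htp S hS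
  refine ⟨hcl, fun d => (S d).card, ?_, ?_, hD⟩
  · rw [Finset.card_eq_one]
    refine ⟨⊤, ?_⟩
    ext I
    rw [hS, Finset.mem_singleton]
    constructor
    · rintro ⟨h, h'⟩
      by_contra hne
      exact (ideg_pos k hfin h hne).ne' h'
    · rintro rfl
      exact ⟨top_ne_bot, ideg_top k hfin⟩
  · intro d
    let PP : Finset (Ideal R) := (hfi d).toFinset.filter (fun I => I.IsMaximal)
    have hPP : ∀ P, P ∈ PP ↔ P.IsMaximal ∧ P ≠ ⊥ ∧ ideg k P ≤ d := by
      intro P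
      simp only [PP, Finset.mem_filter, Set.Finite.mem_toFinset]
      exact and_comm
    rw [zeta_rec k hfin S hS d PP hPP]
    refine Finset.sum_congr rfl fun i hi => ?_
    congr 1
    obtain ⟨F, _, _, _, hF, hc⟩ := hN (i + 1) (Nat.succ_pos i)
    rw [← hc, card_algHom_eq k hfin d (by rw [hF]; exact Finset.mem_range.mp hi) PP hPP, hF]
end Package

section AR
variable {k : Type*} [Field k] (f : k[X])

lemma monic_sq : (X ^ 2 - C f : k[X][X]).Monic := monic_X_pow_sub_C f two_ne_zero

/-- The basis `1, x`. -/
noncomputable def arBasis : Module.Basis (Fin 2) k[X] (AdjoinRoot (X ^ 2 - C f : k[X][X])) :=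
  (AdjoinRoot.powerBasis' (monic_sq f)).basis.reindex (finCongr (by
    rw [AdjoinRoot.powerBasis'_dim]; exact natDegree_X_pow_sub_C))

lemma arBasis_zero : arBasis f 0 = 1 := by
  simp [arBasis]

lemma arBasis_one : arBasis f 1 = AdjoinRoot.root (X ^ 2 - C f : k[X][X]) := by
  simp [arBasis]

lemma root_sq : (AdjoinRoot.root (X ^ 2 - C f : k[X][X])) ^ 2 = algebraMap k[X] _ f := by
  have := AdjoinRoot.eval₂_root (X ^ 2 - C f : k[X][X])
  rw [eval₂_sub, eval₂_pow, eval₂_X, eval₂_C, sub_eq_zero] at this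
  exact this

/-- The conjugation. -/
noncomputable def arConj : AdjoinRoot (X ^ 2 - C f : k[X][X]) →ₐ[k[X]] AdjoinRoot (X ^ 2 - C f : k[X][X]) :=
  AdjoinRoot.liftAlgHom _ (Algebra.ofId _ _) (- AdjoinRoot.root (X ^ 2 - C f : k[X][X])) (by
    rw [eval₂_sub, eval₂_pow, eval₂_X, eval₂_C, neg_sq, root_sq]
    exact sub_self _)

lemma arConj_root : arConj f (AdjoinRoot.root _) = - AdjoinRoot.root _ := by
  simp [arConj]

/-- Points correspond to algebra homomorphisms. -/
noncomputable def arPoints (F : Type*) [Field F] [Algebra k F] :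
    (AdjoinRoot (X ^ 2 - C f : k[X][X]) →ₐ[k] F) ≃
      {xy : F × F // xy.2 ^ 2 = f.eval₂ (algebraMap k F) xy.1} where
  toFun φ := ⟨(φ (AdjoinRoot.of _ X), φ (AdjoinRoot.root _)), by
    rw [← map_pow, root_sq]
    have : ∀ r : k[X], φ (algebraMap k[X] _ r) = r.eval₂ (algebraMap k F) (φ (AdjoinRoot.of _ X)) := by
      intro r
      have : (φ.comp (AdjoinRoot.ofAlgHom k _)) = aeval (φ (AdjoinRoot.of _ X)) := by
        ext; simp
      exact DFunLike.congr_fun this r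
    exact this f⟩
  invFun xy := AdjoinRoot.liftAlgHom _ (aeval xy.1.1) xy.1.2 (by
    rw [eval₂_sub, eval₂_pow, eval₂_X, eval₂_C, xy.2]
    exact sub_self _)
  left_inv φ := by
    apply AdjoinRoot.algHom_ext'
    · ext; simp
    · simp
  right_inv xy := by
    apply Subtype.ext
    simp

lemma card_points_eq {F F' : Type*} [Finite k] [Field F] [Field F'] [Finite F] [Finite F'] (j : k →+* F) (j' : k →+* F')
    (hc : Nat.card F = Nat.card F') :
    Nat.card {xy : F × F // xy.2 ^ 2 = f.eval₂ j xy.1} = Nat.card {xy : F' × F' // xy.2 ^ 2 = f.eval₂ j' xy.1} := by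
  letI := j.toAlgebra
  letI := j'.toAlgebra
  have : Module.Finite k F := Module.Finite.of_finite
  have : Module.Finite k F' := Module.Finite.of_finite
  have hfr : Module.finrank k F = Module.finrank k F' := by
    rw [Module.natCard_eq_pow_finrank (K := k), Module.natCard_eq_pow_finrank (K := k) (V := F')] at hc
    exact Nat.pow_right_injective Finite.one_lt_card hc
  obtain ⟨φ⟩ := FiniteField.nonempty_algHom_iff_finrank_dvd.mpr hfr.dvd
  have hbij : Function.Bijective φ := (Nat.bijective_iff_injective_and_card φ).mpr ⟨φ.toRingHom.injective, hc⟩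
  let e : F ≃ₐ[k] F' := AlgEquiv.ofBijective φ hbij
  refine Nat.card_congr ((Equiv.prodCongr e.toEquiv e.toEquiv).subtypeEquiv ?_)
  rintro ⟨x, y⟩
  have h1 : f.eval₂ j' (e x) = e (f.eval₂ j x) := by
    change aeval (e x) f = e (aeval x f)
    exact aeval_algHom_apply e x f
  change y ^ 2 = f.eval₂ j x ↔ (e y) ^ 2 = f.eval₂ j' (e x)
  rw [h1, ← map_pow, e.injective.eq_iff]

end AR

lemma norm_le_one_of_int {p : ℕ} [Fact p.Prime] (α : PadicAlgCl p) (h : IsIntegral ℤ α) : ‖α‖ ≤ 1 := by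
  by_contra! hlt
  obtain ⟨P, hP, hPα⟩ := h
  have hint : ∀ c : ℤ, ‖(c : PadicAlgCl p)‖ ≤ 1 := by
    intro c
    have h1 : (c : PadicAlgCl p) = ((c : ℚ_[p]) : PadicAlgCl p) := by simp
    rw [h1, PadicAlgCl.norm_extends]
    exact Padic.norm_int_le_one c
  rw [eval₂_eq_sum_range, Finset.sum_range_succ, hP.coeff_natDegree, map_one, one_mul] at hPα
  have hn : P.natDegree ≠ 0 := by
    intro h0
    rw [h0] at hPα
    simp at hPα
  have h2 : α ^ P.natDegree = - ∑ x ∈ Finset.range P.natDegree, (algebraMap ℤ (PadicAlgCl p)) (P.coeff x) * α ^ x := by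
    linear_combination hPα
  have h3 : ‖α ^ P.natDegree‖ ≤ ‖α‖ ^ (P.natDegree - 1) := by
    rw [h2, norm_neg]
    apply IsUltrametricDist.norm_sum_le_of_forall_le_of_nonneg (by positivity)
    intro i hi
    rw [norm_mul, norm_pow, eq_intCast]
    have hi' := Finset.mem_range.mp hi
    calc _ ≤ 1 * ‖α‖ ^ i := by gcongr; exact hint _
      _ ≤ _ := by rw [one_mul]; exact pow_le_pow_right₀ hlt.le (by omega)
  rw [norm_pow] at h3
  exact absurd h3 (not_le.mpr (pow_lt_pow_right₀ hlt (by omega)))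

set_option maxHeartbeats 1000000
set_option synthInstance.maxHeartbeats 400000

/-- **Leitzel–Rosen: linear growth, μ = 0.**
Let `p` be an odd prime, `q` an odd prime power, `f ∈ 𝔽_q[T]` squarefree of odd
degree, and for each `n` let `K n` be the field with `q^(p^n)` elements
(with embeddings `ι n : 𝔽_q →+* K n`), and `R n = K n[T][x]/(x² - f)`, with
`e n = v_p(#Cl(R n))`.  Then there are `λ ∈ ℕ`, `ν ∈ ℤ` and `N` such that
`e n = λ n + ν` for all `n ≥ N`. -/
theorem exists_lambda_nu_classnumber_linear_growth
    {p : ℕ} (hp : p.Prime) (hpodd : Odd p)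
    {q : ℕ} (hq : IsPrimePow q) (hqodd : Odd q)
    {k : Type*} [Field k] [Fintype k] (hk : Fintype.card k = q)
    (K : ℕ → Type*) [∀ n, Field (K n)] [∀ n, Fintype (K n)]
    (hK : ∀ n, Fintype.card (K n) = q ^ p ^ n)
    (ι : ∀ n, k →+* K n)
    (f : k[X]) (hf : Squarefree f) (hdeg : Odd f.natDegree)
    [∀ n, IsDomain (AdjoinRoot (X ^ 2 - C (f.map (ι n)) : ((K n)[X])[X]))] :
    ∃ (lam : ℕ) (ν : ℤ) (N : ℕ), ∀ n ≥ N,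
      ((Nat.card (ClassGroup
          (AdjoinRoot (X ^ 2 - C (f.map (ι n)) : ((K n)[X])[X])))).factorization p : ℤ)
        = lam * n + ν := by
  have hpf : Fact p.Prime := ⟨hp⟩
  have hkq : Nat.card k = q := by rw [Nat.card_eq_fintype_card, hk]
  have hKq : ∀ n, Nat.card (K n) = q ^ p ^ n := fun n => by rw [Nat.card_eq_fintype_card, hK]
  have hN0 : ∀ s : ℕ, ∃ c : ℕ, 0 < s → ∀ (F : Type) [Field F] [Finite F] (j : k →+* F), Nat.card F = q ^ s →
      Nat.card {xy : F × F // xy.2 ^ 2 = f.eval₂ j xy.1} = c := by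
    intro s
    rcases Nat.eq_zero_or_pos s with rfl | hs
    · exact ⟨0, fun h => absurd h (lt_irrefl 0)⟩
    · obtain ⟨ch, hch⟩ := CharP.exists k
      have hchp : Fact ch.Prime := ⟨CharP.char_is_prime k ch⟩
      have : NeZero s := ⟨hs.ne'⟩
      refine ⟨Nat.card {xy : FiniteField.Extension k ch s × FiniteField.Extension k ch s //
        xy.2 ^ 2 = f.eval₂ (algebraMap k _) xy.1}, fun _ F _ _ j hF => ?_⟩
      have : Finite (FiniteField.Extension k ch s) := Module.finite_of_finite k
      apply card_points_eq
      rw [hF, FiniteField.natCard_extension, hkq]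
  choose N hN using hN0
  have hpack : ∀ n, Nat.card (ClassGroup (AdjoinRoot (X ^ 2 - C (f.map (ι n)) : ((K n)[X])[X]))) ≠ 0 ∧
      ∃ a : ℕ → ℕ, a 0 = 1 ∧
      (∀ d, d * a d = ∑ i ∈ Finset.range d, N (p ^ n * (i + 1)) * a (d - (i + 1))) ∧
      ∃ D0, ∀ D ≥ D0, ∑ d ∈ Finset.range (D + 2), a d =
        Nat.card (ClassGroup (AdjoinRoot (X ^ 2 - C (f.map (ι n)) : ((K n)[X])[X]))) +
          Nat.card (K n) * ∑ d ∈ Finset.range (D + 1), a d := by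
    intro n
    have hsq : Squarefree (f.map (ι n)) := by
      have h1 : f.Separable := PerfectField.separable_iff_squarefree.mpr hf
      exact (h1.map (f := ι n)).squarefree
    have hnd : Odd (f.map (ι n)).natDegree := by rwa [natDegree_map]
    have h2 : (2 : K n) ≠ 0 := by
      intro h2
      have hchar : ringChar (K n) = 2 := by
        have : CharP (K n) 2 := CharTwo.of_one_ne_zero_of_two_eq_zero one_ne_zero h2
        exact ringChar.eq_iff.mpr this
      have := FiniteField.even_card_iff_char_two.mp hchar
      rw [hK] at this
      have h3 := (hqodd.pow : Odd (q ^ p ^ n))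
      rw [Nat.odd_iff] at h3
      omega
    refine zeta_package (arBasis (f.map (ι n))) (arBasis_zero _) (f.map (ι n)) ?_ hsq hnd h2
      (arConj _) ?_ (fun s => N (p ^ n * s)) ?_
    · rw [arBasis_one, root_sq]
    · rw [arBasis_one, arConj_root]
    · intro s hs
      obtain ⟨ch, hch⟩ := CharP.exists (K n)
      have hchp : Fact ch.Prime := ⟨CharP.char_is_prime (K n) ch⟩
      have : NeZero s := ⟨hs.ne'⟩
      have hfinE : Finite (FiniteField.Extension (K n) ch s) := Module.finite_of_finite (K n)
      refine ⟨FiniteField.Extension (K n) ch s, inferInstance, inferInstance, hfinE,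
        FiniteField.finrank_extension _ _ _, ?_⟩
      rw [Nat.card_congr (arPoints (f.map (ι n)) (FiniteField.Extension (K n) ch s))]
      simp only [eval₂_map]
      apply hN (p ^ n * s) (Nat.mul_pos (pow_pos hp.pos n) hs)
      rw [FiniteField.natCard_extension, hKq, pow_mul]
  obtain ⟨-, a, ha0, harec, D0, hD0⟩ := hpack 0
  have hKq0 : Nat.card (K 0) = q := by rw [hKq, pow_zero, pow_one]
  obtain ⟨S, hSint, hS⟩ := roots_exist (Ω := PadicAlgCl p) q a N ha0 (by simpa using harec) (D0 + 1) (by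
    intro d hd
    obtain ⟨e, rfl⟩ : ∃ e, d = e + 1 := ⟨d - 1, by omega⟩
    have e1 := hD0 e (by omega)
    have e2 := hD0 (e + 1) (by omega)
    rw [hKq0] at e1 e2
    have s1 := Finset.sum_range_succ a (e + 1)
    have s2 := Finset.sum_range_succ a (e + 2)
    zify at e1 e2 s1 s2 ⊢
    linear_combination e2 - e1 - s2 + (q : ℤ) * s1)
  refine padic_growth S (fun α hα => norm_le_one_of_int α (hSint α hα))
    (fun n => Nat.card (ClassGroup (AdjoinRoot (X ^ 2 - C (f.map (ι n)) : ((K n)[X])[X]))))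
    (fun n => (hpack n).1) (fun n => ?_)
  obtain ⟨-, b, hb0, hbrec, D1, hD1⟩ := hpack n
  refine hS (p ^ n) (pow_pos hp.pos n) b hb0 hbrec _ D1 ?_
  rw [hKq] at hD1
  exact hD1
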